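/- arXiv:1407.5268 — 3 statements merged into one kernel-verified Lean document; each statement's English description precedes it below -/
import Mathlib

section
/- For every integer flow φ on a signed graph G there exists a set 𝒞 of signed circuits of G, each consistently directed with respect to a positive orientation of G (an orientation in which φ is nonnegative on every edge), together with positive integers n_C for C ∈ 𝒞, such that φ = Σ_{C∈𝒞} n_C · χ_C, where χ_C is the characteristic flow of C. -/
/-! ## Signed graphs, bidirected orientations, flows, circuits -/

/-- A signed graph on vertex type `V` and edge type `E`: each edge has two
half-edges (indexed by `Bool`), each with an endpoint, and a sign
(`true` = positive, `false` = negative). -/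
structure SignedGraph (V E : Type) where
  ends : E → Bool → V
  sign : E → Bool

variable {V E : Type}

/-- A bidirected orientation: `dir e i = true` means the half-edge `i` of `e`
is directed *toward* its endpoint.  Positive edges have one half in, one half
out; negative edges have both halves directed the same way. -/
structure SOrientation (G : SignedGraph V E) where
  dir : E → Bool → Bool
  compat : ∀ e, G.sign e = xor (dir e false) (dir e true)

/-- Reverse the orientation on the set of edges where `s e = true`. -/
def SOrientation.reorient {G : SignedGraph V E} (O : SOrientation G) (s : E → Bool) :
    SOrientation G where
  dir := fun e i => xor (s e) (O.dir e i)
  compat := by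
    intro e
    have h := O.compat e
    cases hs : s e <;> simp [hs, h]

/-- Kirchhoff's law: at every vertex the sum of the values on incoming
half-edges equals the sum on outgoing half-edges. -/
def IsFlow [Fintype E] [DecidableEq V] {G : SignedGraph V E} {A : Type} [AddCommGroup A]
    (O : SOrientation G) (f : E → A) : Prop :=
  ∀ v : V,
    (∑ e : E, ∑ i : Bool, if G.ends e i = v ∧ O.dir e i = true then f e else 0)
      = ∑ e : E, ∑ i : Bool, if G.ends e i = v ∧ O.dir e i = false then f e else 0

/-- `G` admits a nowhere-zero integer flow (is flow-admissible). -/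
def HasNZFlow [Fintype E] [DecidableEq V] (G : SignedGraph V E) : Prop :=
  ∃ (O : SOrientation G) (φ : E → ℤ), IsFlow O φ ∧ ∀ e, φ e ≠ 0

/-- `G` admits a nowhere-zero `k`-flow: an integer flow with values in
`{±1, …, ±(k-1)}`. -/
def HasNZkFlow [Fintype E] [DecidableEq V] (G : SignedGraph V E) (k : ℕ) : Prop :=
  ∃ (O : SOrientation G) (φ : E → ℤ), IsFlow O φ ∧ ∀ e, φ e ≠ 0 ∧ (φ e).natAbs ≤ k - 1

/-- A circuit of length `n+1` in `G`: pairwise distinct vertices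
`vtx 0, …, vtx n` and pairwise distinct edges, where edge `i` joins `vtx i`
(via its half `half i`) to `vtx (i+1)` (via the other half); indices cyclic. -/
structure Circuit (G : SignedGraph V E) where
  n : ℕ
  vtx : Fin (n + 1) → V
  edge : Fin (n + 1) → E
  half : Fin (n + 1) → Bool
  vtx_inj : Function.Injective vtx
  edge_inj : Function.Injective edge
  ends_src : ∀ i, G.ends (edge i) (half i) = vtx i
  ends_tgt : ∀ i, G.ends (edge i) (!(half i)) = vtx (i + 1)

/-- Number of edges of a circuit. -/
def Circuit.length {G : SignedGraph V E} (C : Circuit G) : ℕ := C.n + 1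

/-- A circuit is balanced if it has an even number of negative edges. -/
def Circuit.Balanced {G : SignedGraph V E} (C : Circuit G) : Prop :=
  Even (Finset.univ.filter (fun i => G.sign (C.edge i) = false)).card

/-- Consistency of a (raw) bidirection `d` at the vertex `vtx (i+1)` of a
circuit: exactly one of the two half-edges of the circuit at that vertex is
directed toward it. -/
def Circuit.ConsistentAt {G : SignedGraph V E} (C : Circuit G)
    (d : E → Bool → Bool) (i : Fin (C.n + 1)) : Prop :=
  d (C.edge i) (!(C.half i)) ≠ d (C.edge (i + 1)) (C.half (i + 1))

/-- A path of length `m` (possibly trivial, `m = 0`) in `G`. -/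
structure GPath (G : SignedGraph V E) where
  m : ℕ
  vtx : Fin (m + 1) → V
  edge : Fin m → E
  half : Fin m → Bool
  vtx_inj : Function.Injective vtx
  edge_inj : Function.Injective edge
  ends_src : ∀ i, G.ends (edge i) (half i) = vtx i.castSucc
  ends_tgt : ∀ i, G.ends (edge i) (!(half i)) = vtx i.succ

/-- A path is consistently directed (w.r.t. a raw bidirection `d`) if it is
consistent at every internal vertex. -/
def GPath.ConsDir {G : SignedGraph V E} (P : GPath G) (d : E → Bool → Bool) : Prop :=
  ∀ a b : Fin P.m, (a : ℕ) + 1 = (b : ℕ) →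
    d (P.edge a) (!(P.half a)) ≠ d (P.edge b) (P.half b)

/-- A trail of length `m`: distinct edges, vertices may repeat. -/
structure Trail (G : SignedGraph V E) where
  m : ℕ
  vtx : Fin (m + 1) → V
  edge : Fin m → E
  half : Fin m → Bool
  edge_inj : Function.Injective edge
  ends_src : ∀ i, G.ends (edge i) (half i) = vtx i.castSucc
  ends_tgt : ∀ i, G.ends (edge i) (!(half i)) = vtx i.succ

/-- A signed circuit: either a balanced circuit, or an unbalanced bicircuit,
i.e. two unbalanced circuits joined by a (possibly trivial) connecting path
which meets the circuits only at its ends; if the path is trivial the two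
circuits share exactly one vertex, otherwise they are vertex-disjoint. -/
inductive SignedCircuit (G : SignedGraph V E) where
  | balanced (C : Circuit G) (hb : C.Balanced)
  | bicircuit (C₁ C₂ : Circuit G) (P : GPath G)
      (h₁ : ¬ C₁.Balanced) (h₂ : ¬ C₂.Balanced)
      (hstart : P.vtx 0 ∈ Set.range C₁.vtx)
      (hend : P.vtx (Fin.last P.m) ∈ Set.range C₂.vtx)
      (hmeet : ∀ x, x ∈ Set.range C₁.vtx → x ∈ Set.range C₂.vtx →
        P.m = 0 ∧ x = P.vtx 0)
      (hpathint : ∀ k : Fin (P.m + 1), k ≠ 0 → k ≠ Fin.last P.m →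
        P.vtx k ∉ Set.range C₁.vtx ∧ P.vtx k ∉ Set.range C₂.vtx)
      (hedisj : ∀ a b, C₁.edge a ≠ C₂.edge b)
      (hpe₁ : ∀ a b, P.edge a ≠ C₁.edge b)
      (hpe₂ : ∀ a b, P.edge a ≠ C₂.edge b)

namespace SignedCircuit

variable {G : SignedGraph V E}

/-- The edge set of a signed circuit. -/
def edges : SignedCircuit G → Set E
  | balanced C _ => Set.range C.edge
  | bicircuit C₁ C₂ P _ _ _ _ _ _ _ _ _ =>
      Set.range C₁.edge ∪ Set.range C₂.edge ∪ Set.range P.edge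

/-- The vertex set of a signed circuit. -/
def vertices : SignedCircuit G → Set V
  | balanced C _ => Set.range C.vtx
  | bicircuit C₁ C₂ P _ _ _ _ _ _ _ _ _ =>
      Set.range C₁.vtx ∪ Set.range C₂.vtx ∪ Set.range P.vtx

/-- The number of edges (total length) of a signed circuit. -/
def length : SignedCircuit G → ℕ
  | balanced C _ => C.length
  | bicircuit C₁ C₂ P _ _ _ _ _ _ _ _ _ => C₁.length + C₂.length + P.m

/-- Whether a signed circuit is an unbalanced bicircuit. -/
def IsBicircuit : SignedCircuit G → Prop
  | balanced _ _ => False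
  | bicircuit _ _ _ _ _ _ _ _ _ _ _ _ => True

/-- The length of the connecting path (`0` for a balanced circuit). -/
def pathLength : SignedCircuit G → ℕ
  | balanced _ _ => 0
  | bicircuit _ _ P _ _ _ _ _ _ _ _ _ => P.m

open Classical in
/-- The characteristic flow of a signed circuit: `1` on a balanced circuit;
`1` on the connecting path and `1/2` on the two circuits of an unbalanced
bicircuit; `0` elsewhere. -/
noncomputable def chi : SignedCircuit G → E → ℚ
  | balanced C _ => fun e => if e ∈ Set.range C.edge then 1 else 0
  | bicircuit C₁ C₂ P _ _ _ _ _ _ _ _ _ => fun e =>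
      if e ∈ Set.range P.edge then 1
      else if e ∈ Set.range C₁.edge ∪ Set.range C₂.edge then 1/2 else 0

/-- A signed circuit is consistently directed w.r.t. the raw bidirection `d`
if every pair of adjacent edges in it is consistently directed, except at the
faulty vertices: a balanced circuit is consistent everywhere; in an unbalanced
bicircuit each constituent circuit fails to be consistent exactly at the
end-vertex of the connecting path lying on it, while the path itself, and the
junctions of the path (resp. of the other circuit, if the path is trivial)
with the circuits, are consistent. -/
def ConsistentlyDirected (d : E → Bool → Bool) : SignedCircuit G → Prop
  | balanced C _ => ∀ i, C.ConsistentAt d i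
  | bicircuit C₁ C₂ P _ _ _ _ _ _ _ _ _ =>
      (∀ i, C₁.vtx (i + 1) ≠ P.vtx 0 → C₁.ConsistentAt d i) ∧
      (∀ i, C₁.vtx (i + 1) = P.vtx 0 → ¬ C₁.ConsistentAt d i) ∧
      (∀ i, C₂.vtx (i + 1) ≠ P.vtx (Fin.last P.m) → C₂.ConsistentAt d i) ∧
      (∀ i, C₂.vtx (i + 1) = P.vtx (Fin.last P.m) → ¬ C₂.ConsistentAt d i) ∧
      P.ConsDir d ∧
      (∀ k : Fin P.m, (k : ℕ) = 0 → ∀ j, C₁.vtx (j + 1) = P.vtx 0 →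
        d (P.edge k) (P.half k) ≠ d (C₁.edge j) (!(C₁.half j))) ∧
      (∀ k : Fin P.m, (k : ℕ) + 1 = P.m → ∀ j, C₂.vtx (j + 1) = P.vtx (Fin.last P.m) →
        d (P.edge k) (!(P.half k)) ≠ d (C₂.edge j) (!(C₂.half j))) ∧
      (P.m = 0 → ∀ j₁ j₂, C₁.vtx (j₁ + 1) = P.vtx 0 → C₂.vtx (j₂ + 1) = P.vtx 0 →
        d (C₁.edge j₁) (!(C₁.half j₁)) ≠ d (C₂.edge j₂) (!(C₂.half j₂)))

end SignedCircuit

/-- Switching a signed graph at a vertex `v`: the signs of all non-loop edges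
incident with `v` are negated (endpoints are unchanged). -/
def SignedGraph.switch [DecidableEq V] (G : SignedGraph V E) (v : V) : SignedGraph V E where
  ends := G.ends
  sign := fun e =>
    if (G.ends e false = v ∨ G.ends e true = v) ∧ G.ends e false ≠ G.ends e true
    then !(G.sign e) else G.sign e

/-- A circuit of `G` is also a circuit of the switched graph. -/
def Circuit.ofSwitch [DecidableEq V] {G : SignedGraph V E} (v : V) (C : Circuit G) :
    Circuit (G.switch v) :=
  ⟨C.n, C.vtx, C.edge, C.half, C.vtx_inj, C.edge_inj, C.ends_src, C.ends_tgt⟩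

namespace SFD

open Classical in
/-- Number of traversals of an edge by a list of arcs. -/
noncomputable def cnt (l : List (E × Bool)) (e : E) : ℕ := (l.map Prod.fst).count e

/-- Flip the state. -/
def fl (p : V × Bool) : V × Bool := (p.1, !p.2)

/-- Reverse an arc. -/
def rv (a : E × Bool) : E × Bool := (a.1, !a.2)

section
variable {G : SignedGraph V E} (O : SOrientation G)

/-- Tail state of an arc. -/
def tl (a : E × Bool) : V × Bool := (G.ends a.1 a.2, !O.dir a.1 a.2)

/-- Head state of an arc. -/
def hd (a : E × Bool) : V × Bool := (G.ends a.1 (!a.2), O.dir a.1 (!a.2))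

/-- Consistently directed walks between states. -/
def IsWalk : V × Bool → List (E × Bool) → V × Bool → Prop
  | p, [], q => p = q
  | p, a :: l, q => tl O a = p ∧ IsWalk (hd O a) l q

/-- Nonnegative integer combinations of characteristic flows. -/
def Good (f : E → ℚ) : Prop :=
  ∃ n : SignedCircuit G →₀ ℕ, (∀ C ∈ n.support, C.ConsistentlyDirected O.dir) ∧
    ∀ e, f e = n.sum fun C m => (m : ℚ) * C.chi e

end

@[simp] lemma fl_fl (p : V × Bool) : fl (fl p) = p := by simp [fl]

lemma fl_ne (p : V × Bool) : fl p ≠ p := by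
  intro h
  have := congrArg Prod.snd h
  simp [fl] at this

lemma eq_fl {p q : V × Bool} (h1 : p.1 = q.1) (h2 : p ≠ q) : p = fl q := by
  obtain ⟨v, b⟩ := p
  obtain ⟨w, c⟩ := q
  simp only at h1
  subst h1
  cases b <;> cases c <;> simp_all [fl]

variable {G : SignedGraph V E} {O : SOrientation G}

lemma tl_rv (a : E × Bool) : tl O (rv a) = fl (hd O a) := by simp [tl, rv, fl, hd]
lemma hd_rv (a : E × Bool) : hd O (rv a) = fl (tl O a) := by simp [tl, rv, fl, hd]

lemma arc_eq_or {a b : E × Bool} (h : a.1 = b.1) : a = b ∨ a = rv b := by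
  obtain ⟨v, x⟩ := a
  obtain ⟨w, y⟩ := b
  simp only at h
  subst h
  cases x <;> cases y <;> simp_all [rv]

lemma cnt_append (l m : List (E × Bool)) (e : E) : cnt (l ++ m) e = cnt l e + cnt m e := by
  simp [cnt]

lemma cnt_nil (e : E) : cnt [] e = 0 := by simp [cnt]

open Classical in
lemma cnt_cons (a : E × Bool) (l : List (E × Bool)) (e : E) :
    cnt (a :: l) e = cnt l e + if a.1 = e then 1 else 0 := by
  simp [cnt, List.count_cons]

lemma cnt_rev (l : List (E × Bool)) (e : E) : cnt (l.map rv).reverse e = cnt l e := by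
  simp only [cnt, List.map_reverse, List.count_reverse, List.map_map]
  rfl

lemma IsWalk.append {p q r : V × Bool} {l m : List (E × Bool)} (h : IsWalk O p l q)
    (h' : IsWalk O q m r) : IsWalk O p (l ++ m) r := by
  induction l generalizing p with
  | nil => simp only [IsWalk] at h; subst h; simpa using h'
  | cons a l ih => exact ⟨h.1, ih h.2⟩

lemma IsWalk.rev {p q : V × Bool} {l : List (E × Bool)} (h : IsWalk O p l q) :
    IsWalk O (fl q) (l.map rv).reverse (fl p) := by
  induction l generalizing p with
  | nil => simp only [IsWalk] at h; subst h; simp [IsWalk]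
  | cons a l ih =>
    simp only [List.map_cons, List.reverse_cons]
    refine (ih h.2).append ⟨?_, ?_⟩
    · rw [tl_rv]
    · simp only [IsWalk]; rw [hd_rv, h.1]

lemma IsWalk.getStep {p q : V × Bool} {l : List (E × Bool)} (h : IsWalk O p l q) (i : ℕ)
    (hi : i + 1 < l.length) : hd O l[i] = tl O l[i+1] := by
  induction l generalizing p i with
  | nil => simp at hi
  | cons a l ih =>
    cases i with
    | succ i => simpa using ih h.2 i (by simpa using hi)
    | zero =>
      cases l with
      | nil => simp at hi
      | cons b l => simpa using h.2.1.symm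

lemma IsWalk.getFirst {p q : V × Bool} {l : List (E × Bool)} (h : IsWalk O p l q)
    (hi : 0 < l.length) : tl O l[0] = p := by
  cases l with
  | nil => simp at hi
  | cons b l => simpa using h.1

lemma IsWalk.getEnd {p q : V × Bool} {l : List (E × Bool)} (h : IsWalk O p l q) (i : ℕ)
    (hi : i + 1 = l.length) : hd O (l[i]'(by omega)) = q := by
  induction l generalizing p i with
  | nil => simp at hi
  | cons a l ih =>
    cases i with
    | succ i => simpa using ih h.2 i (by simpa using hi)
    | zero =>
      cases l with
      | nil => exact h.2
      | cons b l => simp at hi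

lemma Good.add {f g : E → ℚ} (hf : Good O f) (hg : Good O g) : Good O (fun e => f e + g e) := by
  classical
  obtain ⟨n, hn, hn'⟩ := hf
  obtain ⟨m, hm, hm'⟩ := hg
  refine ⟨n + m, ?_, ?_⟩
  · intro C hC
    rcases Finset.mem_union.1 (Finsupp.support_add hC) with h | h
    · exact hn C h
    · exact hm C h
  · intro e
    show f e + g e = _
    rw [hn', hm', Finsupp.sum_add_index']
    · simp
    · intros; push_cast; ring

lemma Good.zero : Good O (fun _ : E => (0 : ℚ)) := ⟨0, by simp, by simp⟩

lemma Good.single (C : SignedCircuit G) (hC : C.ConsistentlyDirected O.dir) : Good O C.chi := by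
  refine ⟨Finsupp.single C 1, ?_, ?_⟩
  · intro D hD
    have := Finsupp.support_single_subset hD
    simp only [Finset.mem_singleton] at this
    subst this
    exact hC
  · intro e
    simp

lemma Good.congr {f g : E → ℚ} (hf : Good O f) (h : ∀ e, g e = f e) : Good O g := by
  have : g = f := funext h
  rwa [this]

/-! ### Segments of an infinite walk -/

/-- The arcs with indices in `[p, q)`. -/
def seg (a : ℕ → E × Bool) (p q : ℕ) : List (E × Bool) := (List.range' p (q - p)).map a

lemma seg_append (a : ℕ → E × Bool) {p q r : ℕ} (h : p ≤ q) (h' : q ≤ r) :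
    seg a p q ++ seg a q r = seg a p r := by
  unfold seg
  rw [← List.map_append]
  congr 1
  obtain ⟨m, rfl⟩ := Nat.exists_eq_add_of_le h
  obtain ⟨n, rfl⟩ := Nat.exists_eq_add_of_le h'
  have e1 : p + m - p = m := by omega
  have e2 : p + m + n - (p + m) = n := by omega
  have e3 : p + m + n - p = m + n := by omega
  rw [e1, e2, e3, List.range'_append_1]

lemma seg_length (a : ℕ → E × Bool) (p q : ℕ) : (seg a p q).length = q - p := by simp [seg]

lemma cnt_seg_add (a : ℕ → E × Bool) {p q r : ℕ} (h : p ≤ q) (h' : q ≤ r) (e : E) :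
    cnt (seg a p r) e = cnt (seg a p q) e + cnt (seg a q r) e := by
  rw [← seg_append a h h', cnt_append]

lemma seg_shift (a : ℕ → E × Bool) {N : ℕ} (hp : ∀ k, a (k + N) = a k) (p q : ℕ) :
    seg a (p + N) (q + N) = seg a p q := by
  unfold seg
  rw [Nat.add_sub_add_right]
  apply List.ext_getElem
  · simp
  · intro i h1 h2
    simp only [List.getElem_map, List.getElem_range', one_mul]
    rw [← hp (p + i)]
    congr 1
    omega

lemma seg_walk {a : ℕ → E × Bool} (hs : ∀ k, hd O (a k) = tl O (a (k + 1))) {p q : ℕ}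
    (h : p ≤ q) : IsWalk O (tl O (a p)) (seg a p q) (tl O (a q)) := by
  obtain ⟨m, rfl⟩ := Nat.exists_eq_add_of_le h
  clear h
  have e1 : p + m - p = m := by omega
  unfold seg
  rw [e1]
  induction m generalizing p with
  | zero => simp [IsWalk]
  | succ m ih =>
    rw [List.range'_succ, List.map_cons]
    refine ⟨rfl, ?_⟩
    rw [hs]
    have := @ih (p + 1) (by omega)
    rwa [show p + 1 + m = p + (m + 1) by ring] at this

open Classical in
lemma cnt_seg_of_inj (a : ℕ → E × Bool) (p n : ℕ)
    (h : ∀ u w, p ≤ u → u < w → w < p + n → (a u).1 ≠ (a w).1) (e : E) :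
    cnt (seg a p (p + n)) e =
      if e ∈ Set.range (fun t : Fin n => (a (p + t)).1) then 1 else 0 := by
  have e1 : p + n - p = n := by omega
  have hseg : (seg a p (p + n)).map Prod.fst = List.ofFn (fun t : Fin n => (a (p + t)).1) := by
    apply List.ext_getElem
    · simp [seg]
    · intro i h1 h2
      simp [seg]
  have hnd : (List.ofFn (fun t : Fin n => (a (p + t)).1)).Nodup := by
    rw [List.nodup_ofFn]
    intro s t hst
    simp only at hst
    rcases lt_trichotomy (s : ℕ) t with h' | h' | h'
    · exact absurd hst (h _ _ (by omega) (by omega) (by omega))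
    · exact Fin.ext h'
    · exact absurd hst.symm (h _ _ (by omega) (by omega) (by omega))
  unfold cnt
  rw [hseg, hnd.count]
  simp [List.mem_ofFn]

/-- Parity of the number of negative edges. -/
lemma parity {a : ℕ → E × Bool} (hs : ∀ k, hd O (a k) = tl O (a (k + 1))) (p n : ℕ) :
    Even ((Finset.univ.filter (fun t : Fin n => G.sign (a (p + t)).1 = false)).card) ↔
      (tl O (a p)).2 = (tl O (a (p + n))).2 := by
  induction n with
  | zero => simp
  | succ n ih =>
    have hstep : (tl O (a (p + (n + 1)))).2 = xor (tl O (a (p + n))).2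
        (!G.sign (a (p + n)).1) := by
      rw [← add_assoc, ← hs, O.compat]
      rcases a (p + n) with ⟨e, i⟩
      cases i <;> simp only [hd, tl, Bool.not_true, Bool.not_false] <;>
        cases O.dir e false <;> cases O.dir e true <;> rfl
    rw [Finset.card_filter] at ih ⊢
    rw [Fin.sum_univ_castSucc]
    simp only [Fin.val_castSucc, Fin.val_last]
    rw [hstep]
    rcases Bool.eq_false_or_eq_true (G.sign (a (p + n)).1) with hh | hh <;> simp only [hh]
    · simpa using ih
    · simp only [Nat.even_add_one, ih, if_true]
      cases (tl O (a p)).2 <;> cases (tl O (a (p + n))).2 <;> simp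

/-! ### Existence of closed walks under a flow -/

section flow
variable [Fintype E] [DecidableEq V]

/-- Net inflow. -/
def net (O : SOrientation G) (f : E → ℤ) (v : V) : ℤ :=
  ∑ e : E, ∑ i : Bool, if G.ends e i = v then (if O.dir e i = true then f e else -f e) else 0

lemma isFlow_iff (f : E → ℤ) : IsFlow O f ↔ ∀ v, net O f v = 0 := by
  unfold IsFlow net
  refine forall_congr' fun v => ?_
  rw [← sub_eq_zero, ← Finset.sum_sub_distrib]
  have : ∀ e : E, ((∑ i : Bool, if G.ends e i = v ∧ O.dir e i = true then f e else 0) -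
      ∑ i : Bool, if G.ends e i = v ∧ O.dir e i = false then f e else 0) =
      ∑ i : Bool, if G.ends e i = v then (if O.dir e i = true then f e else -f e) else 0 := by
    intro e
    rw [← Finset.sum_sub_distrib]
    refine Finset.sum_congr rfl fun i _ => ?_
    by_cases h : G.ends e i = v <;> cases h' : O.dir e i <;> simp [h]
  rw [Finset.sum_congr rfl fun e _ => this e]

lemma net_add (f g : E → ℤ) (v : V) : net O (fun e => f e + g e) v = net O f v + net O g v := by
  unfold net
  rw [← Finset.sum_add_distrib]
  refine Finset.sum_congr rfl fun e _ => ?_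
  rw [← Finset.sum_add_distrib]
  refine Finset.sum_congr rfl fun i _ => ?_
  split_ifs <;> ring

lemma net_sub (f g : E → ℤ) (v : V) : net O (fun e => f e - g e) v = net O f v - net O g v := by
  have := net_add (O := O) (fun e => f e - g e) g v
  simp only [sub_add_cancel] at this
  rw [this]; ring

/-- Sign of a state at `v`. -/
def sg (p : V × Bool) (v : V) : ℤ := if p.1 = v then (if p.2 = true then 1 else -1) else 0

open Classical in
lemma net_single (a : E × Bool) (v : V) :
    net O (fun e => if a.1 = e then 1 else 0) v = sg (hd O a) v - sg (tl O a) v := by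
  unfold net
  rw [Finset.sum_eq_single a.1]
  · obtain ⟨e, i⟩ := a
    rw [Fintype.sum_bool]
    cases i <;> cases h1 : O.dir e true <;> cases h2 : O.dir e false <;>
      by_cases h3 : G.ends e true = v <;> by_cases h4 : G.ends e false = v <;>
      simp [sg, hd, tl, h1, h2, h3, h4]
  · intro e _ he
    refine Finset.sum_eq_zero fun i _ => ?_
    simp [he.symm]
  · simp

lemma net_walk {p q : V × Bool} {l : List (E × Bool)} (h : IsWalk O p l q) (v : V) :
    net O (fun e => (cnt l e : ℤ)) v = sg q v - sg p v := by
  classical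
  induction l generalizing p with
  | nil =>
    simp only [IsWalk] at h
    subst h
    simp [net, cnt_nil]
  | cons a l ih =>
    have : (fun e => (cnt (a :: l) e : ℤ)) =
        fun e => (cnt l e : ℤ) + (if a.1 = e then (1 : ℤ) else 0) := by
      funext e
      rw [cnt_cons]
      push_cast
      rfl
    rw [this, net_add, net_single, ih h.2, h.1]
    ring

lemma sum_cnt (l : List (E × Bool)) : ∑ e, cnt l e = l.length := by
  classical
  induction l with
  | nil => simp [cnt_nil]
  | cons a l ih => simp [cnt_cons, Finset.sum_add_distrib, ih]

lemma exists_ext {φ : E → ℤ} (hφ : IsFlow O φ) {p q : V × Bool} {l : List (E × Bool)}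
    (h : IsWalk O p l q) (hl : ∀ e, (cnt l e : ℤ) ≤ φ e) (hpq : p ≠ q) :
    ∃ a, tl O a = q ∧ (cnt l a.1 : ℤ) < φ a.1 := by
  by_contra! hcon
  have hn : net O (fun e => φ e - cnt l e) q.1 = sg p q.1 - sg q q.1 := by
    rw [net_sub, (isFlow_iff φ).1 hφ, net_walk h]
    ring
  have key : 0 ≤ (if q.2 = true then (1 : ℤ) else -1) * net O (fun e => φ e - cnt l e) q.1 := by
    unfold net
    rw [Finset.mul_sum]
    refine Finset.sum_nonneg fun e _ => ?_
    rw [Finset.mul_sum]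
    refine Finset.sum_nonneg fun i _ => ?_
    have h1 := hl e
    by_cases h2 : G.ends e i = q.1
    · by_cases h3 : O.dir e i = q.2
      · rw [if_pos h2, h3]
        split_ifs <;> linarith
      · have h4 := hcon (e, i) (Prod.ext h2 (by
          simp only [tl]
          revert h3
          cases O.dir e i <;> cases q.2 <;> simp))
        simp only at h4
        have h5 : φ e - cnt l e = 0 := by omega
        simp [h5]
    · simp [h2]
  rw [hn] at key
  apply hpq
  obtain ⟨v, b⟩ := p
  obtain ⟨w, c⟩ := q
  by_cases h1 : v = w <;> cases b <;> cases c <;> simp_all [sg]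

lemma exists_closed {φ : E → ℤ} (hφ : IsFlow O φ) (h0 : ∀ e, 0 ≤ φ e) (e₀ : E) (he : 0 < φ e₀) :
    ∃ p l, IsWalk O p l p ∧ l ≠ [] ∧ ∀ e, (cnt l e : ℤ) ≤ φ e := by
  classical
  have main : ∀ n : ℕ, ∀ p q l, IsWalk O p l q → l ≠ [] → (∀ e, (cnt l e : ℤ) ≤ φ e) →
      ∑ e, φ e = l.length + n → ∃ p l, IsWalk O p l p ∧ l ≠ [] ∧ ∀ e, (cnt l e : ℤ) ≤ φ e := by
    intro n
    induction n with
    | zero =>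
      intro p q l h hne hl hs
      by_cases hpq : p = q
      · subst hpq; exact ⟨p, l, h, hne, hl⟩
      · obtain ⟨a, ha, ha'⟩ := exists_ext hφ h hl hpq
        exfalso
        have : ∑ e, (cnt l e : ℤ) < ∑ e, φ e :=
          Finset.sum_lt_sum (fun e _ => hl e) ⟨a.1, Finset.mem_univ _, ha'⟩
        have h2 := sum_cnt l
        have h3 : ∑ e, (cnt l e : ℤ) = l.length := by exact_mod_cast h2
        rw [h3, hs] at this
        simp at this
    | succ n ih =>
      intro p q l h hne hl hs
      by_cases hpq : p = q
      · subst hpq; exact ⟨p, l, h, hne, hl⟩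
      · obtain ⟨a, ha, ha'⟩ := exists_ext hφ h hl hpq
        refine ih p (hd O a) (l ++ [a]) (h.append ⟨ha, rfl⟩) (by simp) ?_ ?_
        · intro e
          rw [cnt_append, cnt_cons, cnt_nil]
          have := hl e
          by_cases h1 : a.1 = e
          · subst h1; simp; omega
          · simp [h1, this]
        · rw [hs]; push_cast [List.length_append, List.length_cons, List.length_nil]; ring
  have hw : IsWalk O (tl O (e₀, true)) [(e₀, true)] (hd O (e₀, true)) := ⟨rfl, rfl⟩
  have hl : ∀ e, (cnt [((e₀, true) : E × Bool)] e : ℤ) ≤ φ e := by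
    intro e
    rw [cnt_cons, cnt_nil]
    by_cases h1 : e₀ = e
    · subst h1; simp; omega
    · simp [h1, h0 e]
  have hge : (1 : ℤ) ≤ ∑ e, φ e := by
    have := Finset.single_le_sum (f := φ) (fun e _ => h0 e) (Finset.mem_univ e₀)
    omega
  refine main (∑ e, φ e - 1).toNat _ _ _ hw (by simp) hl ?_
  rw [Int.toNat_of_nonneg (by omega)]
  simp

lemma good_of_closed
    (H : ∀ p l, IsWalk O p l p → Good O (fun e => (cnt l e : ℚ))) :
    ∀ (n : ℕ) (φ : E → ℤ), IsFlow O φ → (∀ e, 0 ≤ φ e) → (∑ e, φ e).toNat = n →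
      Good O (fun e => (φ e : ℚ)) := by
  intro n
  induction n using Nat.strong_induction_on with
  | _ n ih =>
    intro φ hφ h0 hn
    by_cases hz : ∀ e, φ e = 0
    · exact Good.zero.congr (by simp [hz])
    · push Not at hz
      obtain ⟨e₀, he⟩ := hz
      obtain ⟨p, l, hw, hne, hl⟩ := exists_closed hφ h0 e₀ (lt_of_le_of_ne (h0 e₀) he.symm)
      have hpos : 0 < l.length := List.length_pos_iff.2 hne
      have h2 := sum_cnt l
      have h3 : ∑ e, (cnt l e : ℤ) = l.length := by exact_mod_cast h2
      have h4 : ∑ e, (φ e - cnt l e) = ∑ e, φ e - l.length := by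
        rw [Finset.sum_sub_distrib, h3]
      have h5 : 0 ≤ ∑ e, (φ e - cnt l e) := Finset.sum_nonneg fun e _ => by linarith [hl e]
      have hg := ih (∑ e, (φ e - cnt l e)).toNat (by omega) (fun e => φ e - cnt l e) (by
        rw [isFlow_iff]
        intro v
        rw [net_sub, (isFlow_iff φ).1 hφ, net_walk hw]
        ring) (fun e => by linarith [hl e]) rfl
      exact (hg.add (H p l hw)).congr (fun e => by push_cast; ring)

lemma isFlow_reorient {φ : E → ℤ} (hφ : IsFlow O φ) (s : E → Bool) :
    IsFlow (O.reorient s) (fun e => if s e then -φ e else φ e) := by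
  rw [isFlow_iff] at hφ ⊢
  intro v
  rw [← hφ v]
  unfold net
  refine Finset.sum_congr rfl fun e _ => Finset.sum_congr rfl fun i _ => ?_
  by_cases h : G.ends e i = v <;> cases h' : O.dir e i <;> cases h2 : s e <;>
    simp [h, SOrientation.reorient, h', h2]

end flow

/-! ### Circuits from segments -/

lemma vtx_tgt {a : ℕ → E × Bool} (hs : ∀ k, hd O (a k) = tl O (a (k + 1))) (k : ℕ) :
    G.ends (a k).1 (!(a k).2) = (tl O (a (k + 1))).1 := by
  rw [← hs]; rfl

lemma dir_tgt {a : ℕ → E × Bool} (hs : ∀ k, hd O (a k) = tl O (a (k + 1))) (k : ℕ) :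
    O.dir (a k).1 (!(a k).2) = (tl O (a (k + 1))).2 := by
  rw [← hs]; rfl

lemma dir_src (a : E × Bool) : O.dir a.1 a.2 = !(tl O a).2 := by
  simp [tl]

lemma fin_next (n : ℕ) (t : Fin (n + 1)) :
    ((t : ℕ) < n ∧ ((t + 1 : Fin (n + 1)) : ℕ) = t + 1) ∨
      ((t : ℕ) = n ∧ ((t + 1 : Fin (n + 1)) : ℕ) = 0) := by
  rw [Fin.val_add_one]
  by_cases h : t = Fin.last n
  · right; subst h; simp
  · left
    rw [if_neg h]
    refine ⟨?_, rfl⟩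
    have : (t : ℕ) ≠ n := fun h' => h (Fin.ext h')
    omega

/-- Circuit from the segment `[p, p+n+1)`. -/
def mkC (a : ℕ → E × Bool) (hs : ∀ k, hd O (a k) = tl O (a (k + 1))) (p n : ℕ)
    (hc : (tl O (a (p + n + 1))).1 = (tl O (a p)).1)
    (hv : ∀ u w, p ≤ u → u < w → w < p + (n + 1) → (tl O (a u)).1 ≠ (tl O (a w)).1)
    (he : ∀ u w, p ≤ u → u < w → w < p + (n + 1) → (a u).1 ≠ (a w).1) : Circuit G where
  n := n
  vtx := fun t => (tl O (a (p + t))).1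
  edge := fun t => (a (p + t)).1
  half := fun t => (a (p + t)).2
  vtx_inj := by
    intro s t hst
    simp only at hst
    rcases lt_trichotomy (s : ℕ) t with h' | h' | h'
    · exact absurd hst (hv _ _ (by omega) (by omega) (by omega))
    · exact Fin.ext h'
    · exact absurd hst.symm (hv _ _ (by omega) (by omega) (by omega))
  edge_inj := by
    intro s t hst
    simp only at hst
    rcases lt_trichotomy (s : ℕ) t with h' | h' | h'
    · exact absurd hst (he _ _ (by omega) (by omega) (by omega))
    · exact Fin.ext h'
    · exact absurd hst.symm (he _ _ (by omega) (by omega) (by omega))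
  ends_src := fun _ => rfl
  ends_tgt := by
    intro t
    rw [vtx_tgt hs]
    rcases fin_next n t with ⟨h1, h2⟩ | ⟨h1, h2⟩
    · rw [h2]; rfl
    · rw [h2, h1, hc]; rfl

/-- Path from the segment `[p, p+m]`. -/
def mkP (a : ℕ → E × Bool) (hs : ∀ k, hd O (a k) = tl O (a (k + 1))) (p m : ℕ)
    (hv : ∀ u w, p ≤ u → u < w → w ≤ p + m → (tl O (a u)).1 ≠ (tl O (a w)).1)
    (he : ∀ u w, p ≤ u → u < w → w < p + m → (a u).1 ≠ (a w).1) : GPath G where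
  m := m
  vtx := fun t => (tl O (a (p + t))).1
  edge := fun t => (a (p + t)).1
  half := fun t => (a (p + t)).2
  vtx_inj := by
    intro s t hst
    simp only at hst
    rcases lt_trichotomy (s : ℕ) t with h' | h' | h'
    · exact absurd hst (hv _ _ (by omega) (by omega) (by omega))
    · exact Fin.ext h'
    · exact absurd hst.symm (hv _ _ (by omega) (by omega) (by omega))
  edge_inj := by
    intro s t hst
    simp only at hst
    rcases lt_trichotomy (s : ℕ) t with h' | h' | h'
    · exact absurd hst (he _ _ (by omega) (by omega) (by omega))
    · exact Fin.ext h'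
    · exact absurd hst.symm (he _ _ (by omega) (by omega) (by omega))
  ends_src := fun _ => rfl
  ends_tgt := by
    intro t
    rw [vtx_tgt hs]
    rfl

/-- Irreducible periodic closed walk. -/
structure PW (O : SOrientation G) (N : ℕ) (a : ℕ → E × Bool) : Prop where
  hN : 0 < N
  step : ∀ k, hd O (a k) = tl O (a (k + 1))
  per : ∀ k, a (k + N) = a k
  inj : ∀ k l, k < l → l < k + N → tl O (a k) ≠ tl O (a l)
  nc : ∀ p q r s, p < q → q < r → r < s → s < p + N → (tl O (a p)).1 = (tl O (a r)).1 →
    (tl O (a q)).1 ≠ (tl O (a s)).1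

section pw
variable {N : ℕ} {a : ℕ → E × Bool}

lemma PW.flip (h : PW O N a) {k l : ℕ} (hkl : k < l) (hl : l < k + N)
    (hv : (tl O (a k)).1 = (tl O (a l)).1) : tl O (a l) = fl (tl O (a k)) :=
  eq_fl hv.symm (h.inj k l hkl hl).symm

lemma PW.triple (h : PW O N a) {p q r : ℕ} (h1 : p < q) (h2 : q < r) (h3 : r < p + N)
    (hv : (tl O (a p)).1 = (tl O (a q)).1) : (tl O (a p)).1 ≠ (tl O (a r)).1 := by
  intro hv'
  have e1 := h.flip h1 (by omega) hv
  have e2 := h.flip (h1.trans h2) h3 hv'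
  exact h.inj q r h2 (by omega) (e1.trans e2.symm)

lemma PW.edge (h : PW O N a) {u w : ℕ} (h1 : u < w) (h2 : w < u + N) (he : (a u).1 = (a w).1) :
    u + 1 < w ∧ (tl O (a u)).1 = (tl O (a (w + 1))).1 ∧
      (tl O (a (u + 1))).1 = (tl O (a w)).1 := by
  rcases arc_eq_or he with h' | h'
  · exact absurd (by rw [h']) (h.inj u w h1 h2)
  · have e1 : tl O (a u) = fl (tl O (a (w + 1))) := by rw [h', tl_rv, h.step]
    have e2 : tl O (a (u + 1)) = fl (tl O (a w)) := by rw [← h.step, h', hd_rv]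
    refine ⟨?_, by rw [e1]; rfl, by rw [e2]; rfl⟩
    rcases Nat.lt_or_ge (u + 1) w with h3 | h3
    · exact h3
    · have : u + 1 = w := by omega
      rw [this] at e2
      exact absurd e2.symm (fl_ne _)

/-- Edges are distinct along a vertex-simple loop. -/
lemma PW.loop_edge (h : PW O N a) {p n : ℕ} (hn : p + n ≤ p + N)
    (hv : ∀ u w, p ≤ u → u < w → w < p + n → (tl O (a u)).1 ≠ (tl O (a w)).1) :
    ∀ u w, p ≤ u → u < w → w < p + n → (a u).1 ≠ (a w).1 := by
  intro u w h1 h2 h3 he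
  obtain ⟨h4, _, h5⟩ := h.edge h2 (by omega) he
  exact hv (u + 1) w (by omega) h4 h3 h5

lemma PW.balanced (h : PW O N a)
    (hv : ∀ u w, u < w → w < N → (tl O (a u)).1 ≠ (tl O (a w)).1) :
    Good O (fun e => (cnt (seg a 0 N) e : ℚ)) := by
  classical
  obtain ⟨n, rfl⟩ : ∃ n, N = n + 1 := ⟨N - 1, by have := h.hN; omega⟩
  have hv' : ∀ u w, 0 ≤ u → u < w → w < 0 + (n + 1) → (tl O (a u)).1 ≠ (tl O (a w)).1 :=
    fun u w _ h1 h2 => hv u w h1 (by omega)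
  have he := h.loop_edge (by omega) hv'
  have hst : tl O (a (0 + n + 1)) = tl O (a 0) := by
    rw [show 0 + n + 1 = 0 + (n + 1) by ring, h.per]
  let C := mkC a h.step 0 n (by rw [hst]) hv' he
  have hb : C.Balanced := by
    have := (parity h.step 0 (n + 1)).2 (by rw [← add_assoc, hst])
    exact this
  refine (Good.single (SignedCircuit.balanced C hb) ?_).congr ?_
  · intro t
    have D1 : ∀ t : Fin (C.n + 1), O.dir (C.edge t) (!(C.half t)) = (tl O (a (0 + t + 1))).2 :=
      fun t => dir_tgt h.step _
    have B1 : ∀ t : Fin (C.n + 1), O.dir (C.edge t) (C.half t) = !(tl O (a (0 + t))).2 :=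
      fun t => dir_src _
    unfold Circuit.ConsistentAt
    rw [D1, B1]
    rcases fin_next n t with ⟨h1, h2⟩ | ⟨h1, h2⟩
    · have h2' : ((t + 1 : Fin (C.n + 1)) : ℕ) = t + 1 := h2
      rw [h2', ← add_assoc]; simp
    · have h2' : ((t + 1 : Fin (C.n + 1)) : ℕ) = 0 := h2
      rw [h2', h1, hst]; simp
  · intro e
    have h1 := cnt_seg_of_inj a 0 (n + 1) he e
    rw [zero_add] at h1
    rw [h1]
    show _ = if e ∈ Set.range (fun t : Fin (n + 1) => (a (0 + t)).1) then (1 : ℚ) else 0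
    push_cast
    rfl

lemma PW.bicircuit (h : PW O N a) {i j k l : ℕ} (hij : i < j) (hjk : j ≤ k) (hkl : k < l)
    (hli : l ≤ i + N) (v1 : (tl O (a i)).1 = (tl O (a j)).1)
    (v2 : (tl O (a k)).1 = (tl O (a l)).1)
    (s1 : ∀ u w, i ≤ u → u < w → w < j → (tl O (a u)).1 ≠ (tl O (a w)).1)
    (s2 : ∀ u w, k ≤ u → u < w → w < l → (tl O (a u)).1 ≠ (tl O (a w)).1)
    (sp : ∀ u w, j ≤ u → u < w → w ≤ k → (tl O (a u)).1 ≠ (tl O (a w)).1) :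
    Good O (fun e => (cnt (seg a i j) e : ℚ) / 2 + cnt (seg a j k) e +
      (cnt (seg a k l) e : ℚ) / 2) := by
  classical
  have f1 := h.flip hij (by omega) v1
  have f2 := h.flip hkl (by omega) v2
  -- disjointness of vertices
  have d1p : ∀ u w, i ≤ u → u ≤ j → j < w → w ≤ k → (tl O (a u)).1 ≠ (tl O (a w)).1 := by
    intro u w h1 h2 h3 h4 hv
    rcases eq_or_lt_of_le h2 with h5 | h5
    · subst h5; exact sp _ _ le_rfl h3 h4 hv
    rcases eq_or_lt_of_le h1 with h6 | h6
    · subst h6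
      exact h.triple h5 h3 (by omega) v1 hv
    · exact h.nc i u j w h6 h5 h3 (by omega) v1 hv
  have d2p : ∀ u w, k ≤ u → u ≤ l → j ≤ w → w < k → (tl O (a w)).1 ≠ (tl O (a u)).1 := by
    intro u w h1 h2 h3 h4 hv
    rcases eq_or_lt_of_le h1 with h5 | h5
    · subst h5; exact sp _ _ h3 h4 le_rfl hv
    rcases eq_or_lt_of_le h2 with h6 | h6
    · subst h6
      exact sp _ _ h3 h4 le_rfl (hv.trans v2.symm)
    · exact h.nc w k u l h4 h5 h6 (by omega) hv v2
  have d12 : ∀ u w, i ≤ u → u < j → k ≤ w → w < l → (tl O (a u)).1 = (tl O (a w)).1 →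
      j = k ∧ u = i ∧ w = k := by
    intro u w h1 h2 h3 h4 hv
    rcases eq_or_lt_of_le h1 with h5 | h5
    · subst h5
      rcases eq_or_lt_of_le h3 with h6 | h6
      · subst h6
        rcases eq_or_lt_of_le hjk with h7 | h7
        · exact ⟨h7, rfl, rfl⟩
        · exact absurd (v1.symm.trans hv) (sp _ _ le_rfl h7 le_rfl)
      · exact absurd hv (h.triple hij (by omega) (by omega) v1)
    · rcases eq_or_lt_of_le (hjk.trans h3) with h6 | h6
      · subst h6
        exact absurd (v1.trans hv.symm) (s1 _ _ le_rfl h5 h2)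
      · exact absurd hv (h.nc i u j w h5 h2 h6 (by omega) v1)
  -- disjointness of edges
  have ep : ∀ u w, j ≤ u → u < w → w < k → (a u).1 ≠ (a w).1 := by
    intro u w h1 h2 h3 he
    obtain ⟨h4, _, h5⟩ := h.edge h2 (by omega) he
    exact sp (u + 1) w (by omega) h4 (by omega) h5
  have e1p : ∀ u w, i ≤ u → u < j → j ≤ w → w < k → (a u).1 ≠ (a w).1 := by
    intro u w h1 h2 h3 h4 he
    obtain ⟨h5, h6, _⟩ := h.edge (by omega) (by omega) he
    exact d1p u (w + 1) h1 h2.le (by omega) (by omega) h6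
  have e2p : ∀ u w, k ≤ u → u < l → j ≤ w → w < k → (a w).1 ≠ (a u).1 := by
    intro u w h1 h2 h3 h4 he
    obtain ⟨h5, h6, _⟩ := h.edge (by omega) (by omega) he
    exact d2p (u + 1) w (by omega) (by omega) h3 h4 h6
  have e12 : ∀ u w, i ≤ u → u < j → k ≤ w → w < l → (a u).1 ≠ (a w).1 := by
    intro u w h1 h2 h3 h4 he
    obtain ⟨h5, h6, h7⟩ := h.edge (by omega) (by omega) he
    have g1 : j = k ∧ u = i := by
      rcases eq_or_lt_of_le (show w + 1 ≤ l by omega) with h8 | h8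
      · rw [h8, ← v2] at h6
        obtain ⟨x, y, _⟩ := d12 u k h1 h2 le_rfl hkl h6
        exact ⟨x, y⟩
      · obtain ⟨x, y, _⟩ := d12 u (w + 1) h1 h2 (by omega) h8 h6
        exact ⟨x, y⟩
    obtain ⟨rfl, rfl⟩ := g1
    rcases eq_or_lt_of_le (show u + 1 ≤ j by omega) with h8 | h8
    · rw [h8, ← v1] at h7
      obtain ⟨_, _, y⟩ := d12 u w le_rfl h2 h3 h4 h7
      omega
    · obtain ⟨_, y, _⟩ := d12 (u + 1) w (by omega) h8 h3 h4 h7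
      omega
  obtain ⟨n1, rfl⟩ : ∃ n, j = i + n + 1 := ⟨j - i - 1, by omega⟩
  obtain ⟨m, rfl⟩ : ∃ n, k = i + n1 + 1 + n := ⟨k - (i + n1 + 1), by omega⟩
  obtain ⟨n2, rfl⟩ : ∃ n, l = i + n1 + 1 + m + n + 1 := ⟨l - (i + n1 + 1 + m) - 1, by omega⟩
  set p := i + n1 + 1 with hp
  set k := p + m with hk
  have ee1 := h.loop_edge (p := i) (n := n1 + 1) (by omega)
    (fun u w h1 h2 h3 => s1 u w h1 h2 (by omega))
  have ee2 := h.loop_edge (p := k) (n := n2 + 1) (by omega)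
    (fun u w h1 h2 h3 => s2 u w h1 h2 (by omega))
  let C₁ := mkC a h.step i n1 v1.symm (fun u w h1 h2 h3 => s1 u w h1 h2 (by omega)) ee1
  let C₂ := mkC a h.step k n2 v2.symm (fun u w h1 h2 h3 => s2 u w h1 h2 (by omega)) ee2
  let P := mkP a h.step p m sp ep
  have hb1 : ¬ C₁.Balanced := by
    intro hb
    have := (parity h.step i (n1 + 1)).1 hb
    rw [← add_assoc, ← hp, f1] at this
    simp [fl] at this
  have hb2 : ¬ C₂.Balanced := by
    intro hb
    have := (parity h.step k (n2 + 1)).1 hb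
    rw [← add_assoc, f2] at this
    simp [fl] at this
  have hlast : ((Fin.last P.m : Fin (P.m + 1)) : ℕ) = m := rfl
  have P0 : P.vtx 0 = (tl O (a p)).1 := rfl
  have Pl : P.vtx (Fin.last P.m) = (tl O (a k)).1 := rfl
  have V1 : ∀ t, C₁.vtx t = (tl O (a (i + t))).1 := fun t => rfl
  have V2 : ∀ t, C₂.vtx t = (tl O (a (k + t))).1 := fun t => rfl
  have VP : ∀ t, P.vtx t = (tl O (a (p + t))).1 := fun t => rfl
  have lt1 : ∀ t : Fin (C₁.n + 1), (t : ℕ) < n1 + 1 := fun t => t.2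
  have lt2 : ∀ t : Fin (C₂.n + 1), (t : ℕ) < n2 + 1 := fun t => t.2
  have ltP : ∀ t : Fin P.m, (t : ℕ) < m := fun t => t.2
  have ltP' : ∀ t : Fin (P.m + 1), (t : ℕ) < m + 1 := fun t => t.2
  have hPm : P.m = m := rfl
  -- last positions
  have last1 : ∀ t : Fin (C₁.n + 1), C₁.vtx (t + 1) = P.vtx 0 →
      (t : ℕ) = n1 ∧ ((t + 1 : Fin (C₁.n + 1)) : ℕ) = 0 := by
    intro t ht
    rcases fin_next n1 t with ⟨h1, h2⟩ | h1
    · exfalso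
      rw [P0, V1] at ht
      have ht' : (tl O (a (i + (t + 1)))).1 = (tl O (a p)).1 := by rw [← h2]; exact ht
      exact s1 i (i + (t + 1)) le_rfl (by omega) (by omega) (v1.trans ht'.symm)
    · exact h1
  have last2 : ∀ t : Fin (C₂.n + 1), C₂.vtx (t + 1) = P.vtx (Fin.last P.m) →
      (t : ℕ) = n2 ∧ ((t + 1 : Fin (C₂.n + 1)) : ℕ) = 0 := by
    intro t ht
    rcases fin_next n2 t with ⟨h1, h2⟩ | h1
    · exfalso
      rw [Pl, V2] at ht
      have ht' : (tl O (a (k + (t + 1)))).1 = (tl O (a k)).1 := by rw [← h2]; exact ht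
      exact s2 k (k + (t + 1)) le_rfl (by omega) (by omega) ht'.symm
    · exact h1
  have notlast1 : ∀ t : Fin (C₁.n + 1), C₁.vtx (t + 1) ≠ P.vtx 0 →
      ((t + 1 : Fin (C₁.n + 1)) : ℕ) = t + 1 := by
    intro t ht
    rcases fin_next n1 t with ⟨h1, h2⟩ | ⟨h1, h2⟩
    · exact h2
    · exfalso
      apply ht
      have : (t + 1 : Fin (C₁.n + 1)) = 0 := Fin.ext h2
      rw [this, P0, ← v1]
      rfl
  have notlast2 : ∀ t : Fin (C₂.n + 1), C₂.vtx (t + 1) ≠ P.vtx (Fin.last P.m) →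
      ((t + 1 : Fin (C₂.n + 1)) : ℕ) = t + 1 := by
    intro t ht
    rcases fin_next n2 t with ⟨h1, h2⟩ | ⟨h1, h2⟩
    · exact h2
    · exfalso
      apply ht
      have : (t + 1 : Fin (C₂.n + 1)) = 0 := Fin.ext h2
      rw [this, Pl]
      rfl
  have D1 : ∀ t : Fin (C₁.n + 1), O.dir (C₁.edge t) (!(C₁.half t)) = (tl O (a (i + t + 1))).2 :=
    fun t => dir_tgt h.step _
  have D2 : ∀ t : Fin (C₂.n + 1), O.dir (C₂.edge t) (!(C₂.half t)) = (tl O (a (k + t + 1))).2 :=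
    fun t => dir_tgt h.step _
  have DP : ∀ t : Fin P.m, O.dir (P.edge t) (!(P.half t)) = (tl O (a (p + t + 1))).2 :=
    fun t => dir_tgt h.step _
  have B1 : ∀ t : Fin (C₁.n + 1), O.dir (C₁.edge t) (C₁.half t) = !(tl O (a (i + t))).2 :=
    fun t => dir_src _
  have B2 : ∀ t : Fin (C₂.n + 1), O.dir (C₂.edge t) (C₂.half t) = !(tl O (a (k + t))).2 :=
    fun t => dir_src _
  have BP : ∀ t : Fin P.m, O.dir (P.edge t) (P.half t) = !(tl O (a (p + t))).2 :=
    fun t => dir_src _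
  have f1' : (tl O (a p)).2 = !(tl O (a i)).2 := by rw [f1]; rfl
  have f2' : (tl O (a (k + n2 + 1))).2 = !(tl O (a k)).2 := by rw [f2]; rfl
  let B : SignedCircuit G := SignedCircuit.bicircuit C₁ C₂ P hb1 hb2
    ⟨0, v1⟩ ⟨0, rfl⟩
    (by
      rintro x ⟨t, rfl⟩ ⟨t', ht'⟩
      obtain ⟨g1, g2, g3⟩ := d12 (i + t) (k + t') (by omega) (by have := lt1 t; omega) (by omega)
        (by have := lt2 t'; omega) ht'.symm
      refine ⟨by omega, ?_⟩
      rw [V1, g2, P0, v1])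
    (by
      intro t h0 hl
      have t0 : (t : ℕ) ≠ 0 := fun h' => h0 (Fin.ext h')
      have tl' : (t : ℕ) ≠ m := fun h' => hl (Fin.ext h')
      have tb := ltP' t
      constructor
      · rintro ⟨s, hs⟩
        have := lt1 s
        exact d1p (i + s) (p + t) (by omega) (by omega) (by omega) (by omega) hs
      · rintro ⟨s, hs⟩
        have := lt2 s
        exact d2p (k + s) (p + t) (by omega) (by omega) (by omega) (by omega) hs.symm)
    (by
      intro s t
      have := lt1 s
      have := lt2 t
      exact e12 (i + s) (k + t) (by omega) (by omega) (by omega) (by omega))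
    (by
      intro s t
      have := ltP s
      have := lt1 t
      exact (e1p (i + t) (p + s) (by omega) (by omega) (by omega) (by omega)).symm)
    (by
      intro s t
      have := ltP s
      have := lt2 t
      exact e2p (k + t) (p + s) (by omega) (by omega) (by omega) (by omega))
  refine (Good.single B ?_).congr ?_
  · refine ⟨?_, ?_, ?_, ?_, ?_, ?_, ?_, ?_⟩
    · intro t ht
      unfold Circuit.ConsistentAt
      rw [D1, B1, notlast1 t ht, ← add_assoc]
      simp
    · intro t ht
      obtain ⟨g1, g2⟩ := last1 t ht
      unfold Circuit.ConsistentAt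
      rw [D1, B1, g2, g1, ← hp, f1']
      simp
    · intro t ht
      unfold Circuit.ConsistentAt
      rw [D2, B2, notlast2 t ht, ← add_assoc]
      simp
    · intro t ht
      obtain ⟨g1, g2⟩ := last2 t ht
      unfold Circuit.ConsistentAt
      rw [D2, B2, g2, g1, f2']
      simp
    · intro s t hst
      rw [DP, BP, ← hst, ← add_assoc]
      simp
    · intro s hs t ht
      obtain ⟨g1, g2⟩ := last1 t ht
      rw [BP, D1, hs, g1]
      simp [← hp]
    · intro s hs t ht
      obtain ⟨g1, g2⟩ := last2 t ht
      have : p + (s : ℕ) + 1 = k := by omega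
      rw [DP, D2, g1, f2', this]
      simp
    · intro hm s t hs ht
      obtain ⟨g1, _⟩ := last1 s hs
      have hm' : m = 0 := hm
      have hkp : p = k := by omega
      have hl0 : P.vtx 0 = P.vtx (Fin.last P.m) := by rw [P0, Pl, ← hkp]
      obtain ⟨g2, _⟩ := last2 t (ht.trans hl0)
      rw [D1, D2, g1, g2, f2', ← hp, hkp]
      simp
  · intro e
    have c1 := cnt_seg_of_inj a i (n1 + 1) ee1 e
    have c2 := cnt_seg_of_inj a k (n2 + 1) ee2 e
    have cp := cnt_seg_of_inj a p m ep e
    rw [← add_assoc] at c1 c2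
    rw [← hp] at c1
    rw [← hk] at cp
    rw [c1, c2, cp]
    show _ = if e ∈ Set.range P.edge then (1 : ℚ)
      else if e ∈ Set.range C₁.edge ∪ Set.range C₂.edge then 1 / 2 else 0
    have x1 : e ∈ Set.range (fun t : Fin (n1 + 1) => (a (i + t)).1) ↔ e ∈ Set.range C₁.edge :=
      Iff.rfl
    have x2 : e ∈ Set.range (fun t : Fin (n2 + 1) => (a (k + t)).1) ↔ e ∈ Set.range C₂.edge :=
      Iff.rfl
    have xp : e ∈ Set.range (fun t : Fin m => (a (p + t)).1) ↔ e ∈ Set.range P.edge :=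
      Iff.rfl
    simp only [x1, x2, xp]
    have y1 : e ∈ Set.range P.edge → e ∉ Set.range C₁.edge := by
      rintro ⟨s, rfl⟩ ⟨t, ht⟩
      have := ltP s
      have := lt1 t
      exact e1p (i + t) (p + s) (by omega) (by omega) (by omega) (by omega) ht
    have y2 : e ∈ Set.range P.edge → e ∉ Set.range C₂.edge := by
      rintro ⟨s, rfl⟩ ⟨t, ht⟩
      have := ltP s
      have := lt2 t
      exact e2p (k + t) (p + s) (by omega) (by omega) (by omega) (by omega) ht.symm
    have y3 : e ∈ Set.range C₁.edge → e ∉ Set.range C₂.edge := by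
      rintro ⟨s, rfl⟩ ⟨t, ht⟩
      have := lt1 s
      have := lt2 t
      exact e12 (i + s) (k + t) (by omega) (by omega) (by omega) (by omega) ht.symm
    simp only [Set.mem_union]
    by_cases z1 : e ∈ Set.range P.edge
    · simp only [z1, y1 z1, y2 z1, if_true, if_false]; norm_num
    · by_cases z2 : e ∈ Set.range C₁.edge
      · simp only [z1, z2, y3 z2, if_true, if_false, true_or]; norm_num
      · by_cases z3 : e ∈ Set.range C₂.edge
        · simp only [z1, z2, z3, if_true, if_false, or_true]; norm_num
        · simp only [z1, z2, z3, if_false, or_self]; norm_num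

lemma PW.chain (h : PW O N a) {i m : ℕ} (him : i < m) (hm : m < i + N)
    (v0 : (tl O (a i)).1 = (tl O (a m)).1)
    (s0 : ∀ u w, i ≤ u → u < w → w < m → (tl O (a u)).1 ≠ (tl O (a w)).1) :
    ∀ (d c b : ℕ), b + d = i + N → c < b → (c = i ∧ b = m ∨ m ≤ c) →
      (tl O (a c)).1 = (tl O (a b)).1 →
      (∀ u w, c ≤ u → u < w → w < b → (tl O (a u)).1 ≠ (tl O (a w)).1) →
      Good O (fun e => (cnt (seg a c b) e : ℚ) / 2 + cnt (seg a b (i + N)) e +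
        (cnt (seg a i m) e : ℚ) / 2) := by
  classical
  intro d
  induction d using Nat.strong_induction_on with
  | _ d ih =>
    intro c b hd hcb hinv hvc hsc
    by_cases hrep : ∃ y, y ≤ i + N ∧ ∃ x, b ≤ x ∧ x < y ∧ (tl O (a x)).1 = (tl O (a y)).1
    · have hspec := Nat.find_spec hrep
      have hmin := fun z => @Nat.find_min _ _ hrep z
      set y := Nat.find hrep
      obtain ⟨hy, x, hbx, hxy, hv⟩ := hspec
      have hs : ∀ u w, b ≤ u → u < w → w < y → (tl O (a u)).1 ≠ (tl O (a w)).1 := by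
        intro u w h1 h2 h3 h4
        exact hmin w h3 ⟨by omega, u, h1, h2, h4⟩
      have g1 := h.bicircuit hcb hbx hxy (by omega) hvc hv hsc
        (fun u w h1 h2 h3 => hs u w (by omega) h2 h3)
        (fun u w h1 h2 h3 => hs u w h1 h2 (by omega))
      have g2 := ih (i + N - y) (by omega) x y (by omega) hxy (by omega) hv
        (fun u w h1 h2 h3 => hs u w (by omega) h2 h3)
      refine (g1.add g2).congr fun e => ?_
      rw [cnt_seg_add a (hbx.trans hxy.le) hy, cnt_seg_add a hbx hxy.le]
      push_cast
      ring
    · push Not at hrep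
      have vN : ∀ z, tl O (a (z + N)) = tl O (a z) := fun z => by rw [h.per]
      have hmc : m ≤ c := by
        rcases hinv with ⟨_, rfl⟩ | h1
        · exact absurd (by rw [vN, ← v0]) (hrep (i + N) le_rfl b le_rfl hm)
        · exact h1
      have g := h.bicircuit (i := c) (j := b) (k := i + N) (l := m + N) hcb (by omega) (by omega)
        (by omega) hvc (by rw [vN, vN, v0]) hsc
        (by
          intro u w h1 h2 h3
          have := s0 (u - N) (w - N) (by omega) (by omega) (by omega)
          rw [← vN (u - N), ← vN (w - N), Nat.sub_add_cancel (by omega),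
            Nat.sub_add_cancel (by omega)] at this
          exact this)
        (fun u w h1 h2 h3 => hrep w h3 u h1 h2)
      rwa [seg_shift a h.per] at g

lemma cnt_rot (hp : ∀ k, a (k + N) = a k) (i : ℕ) (e : E) :
    cnt (seg a i (i + N)) e = cnt (seg a 0 N) e := by
  induction i with
  | zero => simp
  | succ i ih =>
    rw [← ih]
    have h1 := cnt_seg_add a (p := i) (q := i + 1) (r := i + 1 + N) (by omega) (by omega) e
    have h2 := cnt_seg_add a (p := i) (q := i + N) (r := i + 1 + N) (by omega) (by omega) e
    rw [seg_shift a hp] at h2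
    omega

lemma PW.good (h : PW O N a) : Good O (fun e => (cnt (seg a 0 N) e : ℚ)) := by
  classical
  by_cases hrep : ∃ n, ∃ i, 0 < n ∧ n < N ∧ (tl O (a i)).1 = (tl O (a (i + n))).1
  · have hspec := Nat.find_spec hrep
    have hmin := fun z => @Nat.find_min _ _ hrep z
    set n := Nat.find hrep
    obtain ⟨i, h0, hn, hv⟩ := hspec
    have hs : ∀ u w, i ≤ u → u < w → w < i + n → (tl O (a u)).1 ≠ (tl O (a w)).1 := by
      intro u w h1 h2 h3 h4
      exact hmin (w - u) (by omega) ⟨u, by omega, by omega, by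
        rwa [show u + (w - u) = w by omega]⟩
    have g := h.chain (i := i) (m := i + n) (by omega) (by omega) hv hs (N - n) i (i + n)
      (by omega) (by omega) (Or.inl ⟨rfl, rfl⟩) hv hs
    refine g.congr fun e => ?_
    rw [← cnt_rot h.per i, cnt_seg_add a (q := i + n) (by omega) (by omega)]
    push_cast
    ring
  · push Not at hrep
    refine h.balanced fun u w h1 h2 => ?_
    have := hrep (w - u) u (by omega) (by omega)
    rwa [show u + (w - u) = w by omega] at this

end pw

lemma closed_good : ∀ (n : ℕ) (p : V × Bool) (l : List (E × Bool)), l.length = n →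
    IsWalk O p l p → Good O (fun e => (cnt l e : ℚ)) := by
  intro n
  induction n using Nat.strong_induction_on with
  | _ N ih =>
    intro p l hl hw
    rcases Nat.eq_zero_or_pos N with h0 | hpos
    · have : l = [] := List.length_eq_zero_iff.1 (hl.trans h0)
      subst this
      exact Good.zero.congr (by simp [cnt_nil])
    let a : ℕ → E × Bool := fun k => l[k % N]'(by rw [hl]; exact Nat.mod_lt _ hpos)
    have hper : ∀ k, a (k + N) = a k := by
      intro k
      simp [a]
    have hstep : ∀ k, hd O (a k) = tl O (a (k + 1)) := by
      intro k
      have hk := Nat.mod_lt k hpos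
      by_cases hk' : k % N + 1 < N
      · have e1 : (k + 1) % N = k % N + 1 := by
          rw [Nat.add_mod, Nat.mod_eq_of_lt (show 1 < N by omega), Nat.mod_eq_of_lt hk']
        have := hw.getStep (k % N) (by omega)
        simp only [a, e1]
        exact this
      · have e2 : k % N + 1 = N := by omega
        have e1 : (k + 1) % N = 0 := by
          rw [← Nat.mod_add_mod, e2, Nat.mod_self]
        have h1 := hw.getEnd (k % N) (by omega)
        have h2 := hw.getFirst (by omega)
        simp only [a, e1]
        exact h1.trans h2.symm
    have hseg : seg a 0 N = l := by
      apply List.ext_getElem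
      · simp [seg, hl]
      · intro i h1 h2
        have : i % N = i := Nat.mod_eq_of_lt (by omega)
        simp [seg, a, this]
    have hclosed : ∀ k, tl O (a (k + N)) = tl O (a k) := fun k => by rw [hper]
    by_cases hinj : ∀ k l, k < l → l < k + N → tl O (a k) ≠ tl O (a l)
    · by_cases hnc : ∀ p q r s, p < q → q < r → r < s → s < p + N →
          (tl O (a p)).1 = (tl O (a r)).1 → (tl O (a q)).1 ≠ (tl O (a s)).1
      · have := PW.good (O := O) (N := N) (a := a) ⟨hpos, hstep, hper, hinj, hnc⟩
        rwa [hseg] at this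
      · push Not at hnc
        obtain ⟨p, q, r, s, h1, h2, h3, h4, e1, e2⟩ := hnc
        have f1 : tl O (a r) = fl (tl O (a p)) :=
          eq_fl e1.symm (hinj p r (by omega) (by omega)).symm
        have f2 : tl O (a s) = fl (tl O (a q)) :=
          eq_fl e2.symm (hinj q s (by omega) (by omega)).symm
        have wA := seg_walk hstep h1.le
        have wB := seg_walk hstep h2.le
        have wC := (seg_walk hstep h3.le).rev
        have wD := (seg_walk hstep h4.le).rev
        rw [f1, f2, fl_fl, fl_fl] at wC
        rw [hclosed, f2, fl_fl] at wD
        rw [f1] at wB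
        have g1 := ih _ (by simp [seg_length]; omega) _ _ rfl (wA.append wC)
        have g2 := ih _ (by simp [seg_length]; omega) _ _ rfl (wB.append wD)
        refine (g1.add g2).congr fun e => ?_
        rw [← hseg, ← cnt_rot hper p, cnt_seg_add a (q := q) (by omega) (by omega),
          cnt_seg_add a (p := q) (q := r) (by omega) (by omega),
          cnt_seg_add a (p := r) (q := s) (by omega) (by omega),
          cnt_append, cnt_append, cnt_rev, cnt_rev]
        push_cast
        ring
    · push Not at hinj
      obtain ⟨k, k', h1, h2, h3⟩ := hinj
      have wA := seg_walk hstep h1.le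
      have wB := seg_walk hstep h2.le
      rw [hclosed, h3] at wB
      rw [h3] at wA
      have g1 := ih _ (by rw [seg_length]; omega) _ _ rfl wA
      have g2 := ih _ (by rw [seg_length]; omega) _ _ rfl wB
      refine (g1.add g2).congr fun e => ?_
      rw [← hseg, ← cnt_rot hper k, cnt_seg_add a (q := k') (by omega) (by omega)]
      push_cast
      ring

end SFD

/-- **Decomposition theorem.** For every integer flow `φ` on a signed graph
`G` there is a positive orientation (obtained by reversing some edges and
negating the corresponding flow values, so that the flow is nonnegative on
every edge), a set `𝒞` of signed circuits of `G`, each consistently directed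
with respect to this positive orientation, and positive integers `n_C`, such
that `φ = ∑_{C ∈ 𝒞} n_C • χ_C`. -/
theorem signed_flow_decomposition {V E : Type} [Fintype E] [DecidableEq V]
    (G : SignedGraph V E) (O : SOrientation G) (φ : E → ℤ) (hφ : IsFlow O φ) :
    ∃ s : E → Bool,
      (∀ e, 0 ≤ (if s e then -φ e else φ e)) ∧
      IsFlow (O.reorient s) (fun e => if s e then -φ e else φ e) ∧
      ∃ (𝒞 : Finset (SignedCircuit G)) (n : SignedCircuit G → ℕ),
        (∀ C ∈ 𝒞, C.ConsistentlyDirected (O.reorient s).dir ∧ 0 < n C) ∧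
        ∀ e, (((if s e then -φ e else φ e : ℤ) : ℚ)
          = ∑ C ∈ 𝒞, (n C : ℚ) * C.chi e) := by
  classical
  let s : E → Bool := fun e => decide (φ e < 0)
  have h0 : ∀ e, 0 ≤ (if s e then -φ e else φ e) := by
    intro e
    by_cases h : φ e < 0 <;> simp [s, h] <;> omega
  have hf := SFD.isFlow_reorient hφ s
  refine ⟨s, h0, hf, ?_⟩
  obtain ⟨n, hn, hn'⟩ := SFD.good_of_closed
    (fun p l hw => SFD.closed_good l.length p l rfl hw) _ _ hf h0 rfl
  refine ⟨n.support, n, fun C hC => ⟨hn C hC, ?_⟩, fun e => hn' e⟩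
  exact Nat.pos_of_ne_zero (Finsupp.mem_support_iff.1 hC)
end

section
/- A signed graph G admits a nowhere-zero integer flow if and only if every edge of G belongs to a signed circuit (a balanced circuit or an unbalanced bicircuit). -/
variable {V E : Type}

noncomputable section FlowProof

namespace SignedGraph

/-- Source of a dart. -/
def src (G : SignedGraph V E) (d : E × Bool) : V := G.ends d.1 d.2
/-- Target of a dart. -/
def tgt (G : SignedGraph V E) (d : E × Bool) : V := G.ends d.1 (!d.2)
/-- Reversed dart. -/
def rv (d : E × Bool) : E × Bool := (d.1, !d.2)

/-- Walks as lists of darts. -/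
def IsW (G : SignedGraph V E) : V → List (E × Bool) → V → Prop
  | u, [], w => u = w
  | u, d :: l, w => G.src d = u ∧ IsW G (G.tgt d) l w

/-- Sign of a dart. -/
def s1 (G : SignedGraph V E) (d : E × Bool) : ℤ := if G.sign d.1 = true then 1 else -1

/-- Sign of a list of darts. -/
def sg (G : SignedGraph V E) (l : List (E × Bool)) : ℤ := (l.map G.s1).prod

/-- Closed list circuits. -/
structure LC (G : SignedGraph V E) (u : V) (l : List (E × Bool)) : Prop where
  walk : G.IsW u l u
  ne : l ≠ []
  nd : (l.map G.src).Nodup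
  edn : (l.map Prod.fst).Nodup

variable {G : SignedGraph V E}

lemma src_rv (d : E × Bool) : G.src (rv d) = G.tgt d := rfl
lemma tgt_rv (d : E × Bool) : G.tgt (rv d) = G.src d := by simp [rv, src, tgt]
lemma rv_rv (d : E × Bool) : rv (rv d) = d := by simp [rv]
lemma rv_fst (d : E × Bool) : (rv d).1 = d.1 := rfl
lemma rv_ne (d : E × Bool) : rv d ≠ d := by
  rcases d with ⟨e, b⟩; cases b <;> simp [rv]
lemma eq_or_rv {d d' : E × Bool} (h : d.1 = d'.1) : d = d' ∨ d = rv d' := by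
  rcases d with ⟨e, b⟩; rcases d' with ⟨e', b'⟩
  simp only at h; subst h
  cases b <;> cases b' <;> simp [rv]

lemma s1_sq (d : E × Bool) : G.s1 d * G.s1 d = 1 := by
  unfold s1; split_ifs <;> norm_num
lemma s1_rv (d : E × Bool) : G.s1 (rv d) = G.s1 d := rfl

lemma sg_nil : G.sg [] = 1 := rfl
lemma sg_cons (d) (l) : G.sg (d :: l) = G.s1 d * G.sg l := by simp [sg]
lemma sg_append (l l') : G.sg (l ++ l') = G.sg l * G.sg l' := by simp [sg]
lemma sg_sq (l) : G.sg l * G.sg l = 1 := by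
  induction l with
  | nil => simp [sg]
  | cons d l ih =>
    rw [sg_cons]
    calc _ = (G.s1 d * G.s1 d) * (G.sg l * G.sg l) := by ring
      _ = 1 := by rw [ih, s1_sq]; rfl
lemma sg_cases (l) : G.sg l = 1 ∨ G.sg l = -1 := by
  have h := G.sg_sq l
  exact mul_self_eq_one_iff.mp h
lemma sg_perm {l l'} (h : List.Perm l l') : G.sg l = G.sg l' := (h.map _).prod_eq

lemma isW_append {u w : V} {l l' : List (E × Bool)} :
    G.IsW u (l ++ l') w ↔ ∃ x, G.IsW u l x ∧ G.IsW x l' w := by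
  induction l generalizing u with
  | nil => simp [IsW]
  | cons d l ih => simp [IsW, ih, and_assoc]

lemma isW_eq {u w : V} {l : List (E × Bool)} (h : G.IsW u l w) :
    l.map G.src ++ [w] = u :: l.map G.tgt := by
  induction l generalizing u with
  | nil => simp [IsW] at h; simp [h]
  | cons d l ih =>
    obtain ⟨h1, h2⟩ := h
    simp [ih h2, h1]

/-- reverse walk -/
def rvl (l : List (E × Bool)) : List (E × Bool) := (l.map rv).reverse

lemma isW_rvl {u w : V} {l : List (E × Bool)} (h : G.IsW u l w) : G.IsW w (rvl l) u := by
  induction l generalizing u with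
  | nil => exact h.symm
  | cons d l ih =>
    obtain ⟨h1, h2⟩ := h
    have := ih h2
    simp only [rvl, List.map_cons, List.reverse_cons]
    refine isW_append.mpr ⟨_, this, ?_⟩
    exact ⟨rfl, by rw [tgt_rv, h1]; rfl⟩

lemma sg_rvl (l) : G.sg (rvl l) = G.sg l := by
  unfold rvl
  rw [sg_perm (List.reverse_perm _)]
  unfold sg
  simp [Function.comp_def, s1_rv]

lemma rvl_fst (l : List (E × Bool)) : (rvl l).map Prod.fst = (l.map Prod.fst).reverse := by
  simp [rvl, Function.comp_def, rv_fst]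
lemma rvl_src (l : List (E × Bool)) : (rvl l).map G.src = (l.map G.tgt).reverse := by
  simp [rvl, Function.comp_def, src_rv]

/-- split a walk at a source vertex -/
lemma isW_split {u w t : V} {l : List (E × Bool)} (h : G.IsW u l w) (ht : t ∈ l.map G.src) :
    ∃ a d b, l = a ++ d :: b ∧ G.src d = t ∧ G.IsW u a t ∧ G.IsW t (d :: b) w := by
  obtain ⟨d, hd, rfl⟩ := List.mem_map.mp ht
  obtain ⟨a, b, rfl⟩ := List.append_of_mem hd
  obtain ⟨x, hx1, hx2⟩ := isW_append.mp h
  obtain rfl := hx2.1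
  exact ⟨a, d, b, rfl, rfl, hx1, hx2⟩

lemma LC.rot {u t : V} {l : List (E × Bool)} (h : G.LC u l) (ht : t ∈ l.map G.src) :
    ∃ d b, G.LC t (d :: b) ∧ G.src d = t ∧ List.Perm (d :: b) l := by
  obtain ⟨a, d, b, rfl, hd, h1, h2⟩ := isW_split h.walk ht
  have hp : List.Perm (d :: (b ++ a)) (a ++ d :: b) := by
    have := List.perm_append_comm (l₁ := d :: b) (l₂ := a)
    simpa using this
  refine ⟨d, b ++ a, ⟨?_, by simp, ?_, ?_⟩, hd, hp⟩
  · have := isW_append.mpr ⟨_, h2, h1⟩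
    simpa using this
  · exact (hp.map _).nodup_iff.mpr h.nd
  · exact (hp.map _).nodup_iff.mpr h.edn

lemma LC.perm {u : V} {l : List (E × Bool)} (h : G.LC u l) :
    List.Perm (l.map G.tgt) (l.map G.src) := by
  have := isW_eq h.walk
  have h2 : List.Perm (u :: l.map G.tgt) (u :: l.map G.src) := by
    rw [← this]; exact List.perm_append_singleton _ _
  exact (List.perm_cons u).mp h2

lemma LC.mem_start {u : V} {l : List (E × Bool)} (h : G.LC u l) : u ∈ l.map G.src := by
  obtain ⟨h1, h2, _, _⟩ := h
  cases l with
  | nil => exact absurd rfl h2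
  | cons d l => simp [← h1.1]

/-- state of the exploration -/
structure St (G : SignedGraph V E) (X : Set V) (S : Set E) (u : V) (l : List (E × Bool)) (w : V) :
    Prop where
  ne : l ≠ []
  walk : G.IsW u l w
  nd : (l.map G.src ++ [w]).Nodup
  ed : (l.map Prod.fst).Nodup
  inS : ∀ d ∈ l, d.1 ∈ S
  offX : ∀ d ∈ l, G.tgt d ∉ X

/-- an ear -/
structure Ear (G : SignedGraph V E) (X : Set V) (S : Set E) (u : V) (l : List (E × Bool)) (t : V) :
    Prop where
  ne : l ≠ []
  walk : G.IsW u l t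
  tX : t ∈ X
  nd : (l.map G.src).Nodup
  ed : (l.map Prod.fst).Nodup
  inS : ∀ d ∈ l, d.1 ∈ S
  offX : ∀ x ∈ (l.map G.src).tail, x ∉ X

/-- a lollipop -/
structure Lol (G : SignedGraph V E) (X : Set V) (S : Set E) (u : V) (p c : List (E × Bool))
    (x : V) : Prop where
  wp : G.IsW u p x
  wc : G.IsW x c x
  ne : c ≠ []
  nd : ((p ++ c).map G.src).Nodup
  ed : ((p ++ c).map Prod.fst).Nodup
  inS : ∀ d ∈ p ++ c, d.1 ∈ S
  offX : ∀ d ∈ p ++ c, G.tgt d ∉ X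

lemma step {X : Set V} {S : Set E}
    (hdeg : ∀ d : E × Bool, d.1 ∈ S → G.tgt d ∉ X →
      ∃ d', d' ≠ rv d ∧ G.src d' = G.tgt d ∧ d'.1 ∈ S) {u : V} {l : List (E × Bool)} {w : V}
    (h : G.St X S u l w) :
    (∃ l' t, G.Ear X S u l' t) ∨ (∃ p c x, G.Lol X S u p c x) ∨
      ∃ d w', G.St X S u (l ++ [d]) w' := by
  obtain ⟨hne, hw, hnd, hed, hS, hX⟩ := h
  have heq := isW_eq hw
  obtain ⟨l0, dl, rfl⟩ := List.eq_nil_or_concat' l |>.resolve_left hne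
  have hdl : G.tgt dl = w := by
    obtain ⟨x, _, hx⟩ := isW_append.mp hw
    exact hx.2
  have htn : (u :: (l0 ++ [dl]).map G.tgt).Nodup := heq ▸ hnd
  obtain ⟨d', hd1, hd2, hd3⟩ := hdeg dl (hS _ (by simp)) (hX _ (by simp))
  set l := l0 ++ [dl] with hl
  have hdm : dl ∈ l := by simp [hl]
  have hwsrc : w ∉ l.map G.src := by
    intro hc
    exact (List.nodup_append.mp hnd).2.2 w hc w (by simp) rfl
  have hnew : d'.1 ∉ l.map Prod.fst := by
    intro hc
    obtain ⟨q, hq, hqe⟩ := List.mem_map.mp hc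
    rcases eq_or_rv hqe.symm with h | h
    · apply hwsrc
      rw [← hdl, ← hd2, h]
      exact List.mem_map_of_mem hq
    · have h1 : G.tgt q = G.tgt dl := by rw [← hd2, h, src_rv]
      have h2 := List.inj_on_of_nodup_map (List.nodup_cons.mp htn).2 hq hdm h1
      exact hd1 (by rw [h, h2])
  have hed' : ((l ++ [d']).map Prod.fst).Nodup := by
    rw [List.map_append, List.nodup_append]
    refine ⟨hed, by simp, ?_⟩
    intro a ha b hb hab
    simp at hb
    subst hb hab
    exact hnew ha
  have hw' : G.IsW u (l ++ [d']) (G.tgt d') :=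
    isW_append.mpr ⟨w, hw, by rw [hd2, hdl], rfl⟩
  have hnd' : ((l ++ [d']).map G.src).Nodup := by
    simpa [hd2, hdl] using hnd
  have hS' : ∀ d ∈ l ++ [d'], d.1 ∈ S := by
    intro d hd
    rcases List.mem_append.mp hd with h | h
    · exact hS _ h
    · simp at h; subst h; exact hd3
  by_cases htX : G.tgt d' ∈ X
  · left
    refine ⟨l ++ [d'], _, by simp, hw', htX, hnd', hed', hS', ?_⟩
    have h3 : (l ++ [d']).map G.src = u :: l.map G.tgt := by
      rw [← heq]; simp [hd2, hdl]
    rw [h3]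
    intro x hx
    simp only [List.tail_cons] at hx
    obtain ⟨q, hq, rfl⟩ := List.mem_map.mp hx
    exact hX q hq
  have hX' : ∀ d ∈ l ++ [d'], G.tgt d ∉ X := by
    intro d hd
    rcases List.mem_append.mp hd with h | h
    · exact hX _ h
    · simp at h; subst h; exact htX
  right
  by_cases hrep : G.tgt d' ∈ (l ++ [d']).map G.src
  · left
    obtain ⟨a, d, b, hab, hd, ha, hb⟩ := isW_split hw' hrep
    refine ⟨a, d :: b, _, ha, hb, by simp, ?_, ?_, ?_, ?_⟩ <;> rw [← hab] <;> assumption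
  · right
    refine ⟨d', G.tgt d', by simp, hw', ?_, hed', hS', hX'⟩
    rw [List.nodup_append]
    refine ⟨hnd', by simp, ?_⟩
    intro a ha b hb hab
    simp at hb
    subst hb hab
    exact hrep ha

/-- Exploration lemma. -/
lemma explore [Fintype E] {X : Set V} {S : Set E}
    (hdeg : ∀ d : E × Bool, d.1 ∈ S → G.tgt d ∉ X →
      ∃ d', d' ≠ rv d ∧ G.src d' = G.tgt d ∧ d'.1 ∈ S) (u : V) :
    ∀ (n : ℕ) (l : List (E × Bool)) (w : V), Fintype.card E < l.length + n →
      G.St X S u l w →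
    (∃ l' t, G.Ear X S u l' t) ∨ (∃ p c x, G.Lol X S u p c x) := by
  intro n
  induction n with
  | zero =>
    intro l w hn h
    have := List.Nodup.length_le_card h.ed
    simp at this
    omega
  | succ n ih =>
    intro l w hn h
    rcases step hdeg h with h1 | h1 | ⟨d, w', h1⟩
    · exact Or.inl h1
    · exact Or.inr h1
    · exact ih _ _ (by simp; omega) h1

lemma explore' [Fintype E] {X : Set V} {S : Set E}
    (hdeg : ∀ d : E × Bool, d.1 ∈ S → G.tgt d ∉ X →
      ∃ d', d' ≠ rv d ∧ G.src d' = G.tgt d ∧ d'.1 ∈ S) (d : E × Bool) (hd : d.1 ∈ S) :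
    (∃ l' t, G.Ear X S (G.src d) l' t) ∨ (∃ p c x, G.Lol X S (G.src d) p c x) := by
  by_cases htX : G.tgt d ∈ X
  · left
    exact ⟨[d], G.tgt d, by simp, ⟨rfl, rfl⟩, htX, by simp, by simp, by simpa using hd, by simp⟩
  by_cases hl : G.src d = G.tgt d
  · right
    exact ⟨[], [d], G.src d, rfl, ⟨rfl, hl.symm⟩, by simp, by simp, by simp, by simpa using hd,
      by simpa using htX⟩
  · refine explore hdeg _ (Fintype.card E) [d] (G.tgt d) (by simp) ?_
    exact ⟨by simp, ⟨rfl, rfl⟩, by simpa using hl, by simp, by simpa using hd, by simpa using htX⟩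

/-! Conversion between list circuits and circuits -/

/-- list of darts of a circuit -/
def _root_.Circuit.toL (C : Circuit G) : List (E × Bool) := List.ofFn fun i => (C.edge i, C.half i)

/-- list of darts of a path -/
def _root_.GPath.toL (C : GPath G) : List (E × Bool) := List.ofFn fun i => (C.edge i, C.half i)

lemma isW_ofFn {m : ℕ} (g : Fin m → E × Bool) (v : Fin (m + 1) → V)
    (h1 : ∀ i, G.src (g i) = v i.castSucc) (h2 : ∀ i, G.tgt (g i) = v i.succ) :
    G.IsW (v 0) (List.ofFn g) (v (Fin.last m)) := by
  induction m with
  | zero => simp [IsW]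
  | succ m ih =>
    rw [List.ofFn_succ]
    refine ⟨h1 0, ?_⟩
    rw [h2 0]
    exact ih (fun i => g i.succ) (fun i => v i.succ) (fun i => by rw [h1]; rfl) (fun i => h2 _)

lemma gpath_isW (P : GPath G) : G.IsW (P.vtx 0) P.toL (P.vtx (Fin.last P.m)) :=
  isW_ofFn _ _ P.ends_src P.ends_tgt

lemma mem_toL_fst (C : Circuit G) (e : E) : e ∈ C.toL.map Prod.fst ↔ e ∈ Set.range C.edge := by
  simp only [Circuit.toL, List.map_ofFn, List.mem_ofFn, Function.comp_def, Set.mem_range]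
lemma mem_toL_src (C : Circuit G) (x : V) : x ∈ C.toL.map G.src ↔ x ∈ Set.range C.vtx := by
  simp only [Circuit.toL, List.map_ofFn, List.mem_ofFn, Function.comp_def, src, C.ends_src, Set.mem_range]
lemma mem_ptoL_fst (C : GPath G) (e : E) : e ∈ C.toL.map Prod.fst ↔ e ∈ Set.range C.edge := by
  simp [GPath.toL, List.mem_ofFn]

lemma circuit_LC (C : Circuit G) : G.LC (C.vtx 0) C.toL := by
  refine ⟨?_, by simp [Circuit.toL], ?_, ?_⟩
  · have := isW_ofFn (G := G) (fun i => (C.edge i, C.half i))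
      (fun i : Fin (C.n + 1 + 1) => C.vtx (Fin.ofNat (C.n + 1) i.val)) ?_ ?_
    · simpa [Circuit.toL] using this
    · intro i
      simp [src, C.ends_src]
    · intro i
      simp only [tgt, C.ends_tgt]
      congr 1
      ext
      simp [Fin.val_add]
  · simp only [Circuit.toL, List.map_ofFn]
    rw [List.nodup_ofFn]
    intro i j h
    simp only [Function.comp, src, C.ends_src] at h
    exact C.vtx_inj h
  · simp only [Circuit.toL, List.map_ofFn]
    rw [List.nodup_ofFn]
    exact C.edge_inj

lemma gpath_ed (P : GPath G) : (P.toL.map Prod.fst).Nodup := by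
  simp only [GPath.toL, List.map_ofFn]
  rw [List.nodup_ofFn]
  exact P.edge_inj

lemma sg_circuit (C : Circuit G) : G.sg C.toL = 1 ↔ C.Balanced := by
  have : G.sg C.toL = (-1) ^ (Finset.univ.filter (fun i => G.sign (C.edge i) = false)).card := by
    simp only [sg, Circuit.toL, List.map_ofFn, List.prod_ofFn, Function.comp, s1]
    rw [← Finset.prod_const, Finset.prod_filter]
    refine Finset.prod_congr rfl fun i _ => ?_
    cases G.sign (C.edge i) <;> simp
  rw [this, Circuit.Balanced]
  exact neg_one_pow_eq_one_iff_even (by norm_num)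

lemma exists_circuit {u : V} {l : List (E × Bool)} (h : G.LC u l) : ∃ C : Circuit G, C.toL = l := by
  obtain ⟨hw, hne, hnd, hed⟩ := h
  cases l with
  | nil => exact absurd rfl hne
  | cons d r =>
    have heq := isW_eq hw
    refine ⟨⟨r.length, fun i => G.src ((d :: r).get i), fun i => ((d :: r).get i).1,
      fun i => ((d :: r).get i).2, ?_, ?_, fun i => rfl, ?_⟩, ?_⟩
    · intro i j hij
      have := List.inj_on_of_nodup_map hnd (List.get_mem _ _) (List.get_mem _ _) hij
      exact (List.Nodup.of_map _ hnd).injective_get this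
    · intro i j hij
      have := List.inj_on_of_nodup_map hed (List.get_mem _ _) (List.get_mem _ _) hij
      exact (List.Nodup.of_map _ hnd).injective_get this
    · intro i
      change G.tgt ((d :: r).get i) = _
      have h1 := congrArg (fun L => L[i.val + 1]?) heq
      have hi := i.isLt
      by_cases hlt : i.val < r.length
      · have h2 : (i + 1).val = i.val + 1 := by
          rw [Fin.val_add_one_of_lt]
          exact Fin.lt_def.mpr (by simpa using hlt)
        simp [List.getElem?_append, hlt] at h1
        simp only [h2, List.get_eq_getElem, List.getElem_cons_succ]
        rw [← List.map_cons, List.getElem?_map, List.getElem?_eq_getElem (by simpa using hi)] at h1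
        simpa using h1.symm
      · have h3 : i = Fin.last r.length := by ext; simp; omega
        subst h3
        simp at h1
        simp only [List.get_eq_getElem, Fin.val_last, Fin.last_add_one, Fin.val_zero,
          List.getElem_cons_zero]
        rw [hw.1, h1]
        simp only [← List.map_cons, List.getElem_map]
    · simp [Circuit.toL]


lemma exists_path {u x : V} {p : List (E × Bool)} (hw : G.IsW u p x)
    (hnd : (p.map G.src ++ [x]).Nodup) (hed : (p.map Prod.fst).Nodup) :
    ∃ P : GPath G, P.toL = p ∧ P.m = p.length ∧ P.vtx 0 = u ∧ P.vtx (Fin.last P.m) = x ∧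
      (∀ k, k ≠ 0 → P.vtx k ∈ p.map G.tgt) ∧ (∀ k, k ≠ Fin.last P.m → P.vtx k ∈ p.map G.src) := by
  have heq := isW_eq hw
  have hv : ∀ i : Fin p.length, (p.map G.src ++ [x])[i.val + 1]'(by simp) = G.tgt p[i] := by
    intro i
    have : (p.map G.src ++ [x])[i.val + 1]? = some (G.tgt p[i]) := by
      rw [heq]; simp
    rw [List.getElem?_eq_getElem (by simp)] at this
    exact Option.some.inj this
  refine ⟨⟨p.length, fun i => (p.map G.src ++ [x])[i.val]'(by simpa using i.isLt), fun i => (p[i]).1,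
    fun i => (p[i]).2, ?_, ?_, ?_, ?_⟩, ?_, rfl, ?_, ?_, ?_, ?_⟩
  · intro i j hij
    have := (List.Nodup.getElem_inj_iff hnd).mp hij
    exact Fin.ext this
  · intro i j hij
    have h1 := List.inj_on_of_nodup_map hed (List.getElem_mem _) (List.getElem_mem _) hij
    have := (List.Nodup.getElem_inj_iff (List.Nodup.of_map _ hed)).mp h1
    exact Fin.ext this
  · intro i
    simp [src]
  · intro i
    have := hv i
    simp only [Fin.val_succ]
    rw [this]
    rfl
  · simp [GPath.toL]
  · simp only [heq]; simp
  · simp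
  · intro k hk
    obtain ⟨j, rfl⟩ := Fin.exists_succ_eq.mpr hk
    simp only [Fin.val_succ]
    have := hv j
    rw [this]
    exact List.mem_map_of_mem (List.getElem_mem _)
  · intro k hk
    obtain ⟨j, rfl⟩ := Fin.exists_castSucc_eq.mpr hk
    simp only [Fin.val_castSucc]
    rw [List.getElem_append_left (by simp)]
    exact List.getElem_mem _

lemma exists_bal {u : V} {l : List (E × Bool)} (h : G.LC u l) (hs : G.sg l = 1) :
    ∃ C : SignedCircuit G, ∀ e ∈ C.edges, e ∈ l.map Prod.fst := by
  obtain ⟨C, rfl⟩ := exists_circuit h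
  exact ⟨.balanced C ((sg_circuit C).mp hs), fun e he => (mem_toL_fst C e).mpr he⟩

lemma exists_bic {u0 u x : V} {c p c2 : List (E × Bool)} (h1 : G.LC u0 c) (h2 : G.LC x c2)
    (hs1 : G.sg c ≠ 1) (hs2 : G.sg c2 ≠ 1) (hu : u ∈ c.map G.src) (hw : G.IsW u p x)
    (hnd : (p.map G.src ++ [x]).Nodup) (hed : (p.map Prod.fst).Nodup)
    (hmeet : ∀ y ∈ c.map G.src, y ∈ c2.map G.src → p = [] ∧ y = u)
    (hinn : ∀ y ∈ p.map G.src, y ∈ p.map G.tgt → y ∉ c.map G.src ∧ y ∉ c2.map G.src)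
    (he12 : ∀ e ∈ c.map Prod.fst, e ∉ c2.map Prod.fst)
    (hep1 : ∀ e ∈ p.map Prod.fst, e ∉ c.map Prod.fst)
    (hep2 : ∀ e ∈ p.map Prod.fst, e ∉ c2.map Prod.fst) :
    ∃ C : SignedCircuit G, ∀ e ∈ C.edges,
      e ∈ c.map Prod.fst ∨ e ∈ c2.map Prod.fst ∨ e ∈ p.map Prod.fst := by
  obtain ⟨C1, rfl⟩ := exists_circuit h1
  obtain ⟨C2, rfl⟩ := exists_circuit h2
  obtain ⟨P, rfl, hm, hP0, hPl, hPt, hPs⟩ := exists_path hw hnd hed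
  have hx := h2.mem_start
  simp only [mem_toL_src, mem_toL_fst, mem_ptoL_fst] at *
  rw [Ne, sg_circuit] at hs1 hs2
  refine ⟨.bicircuit C1 C2 P hs1 hs2 (by rw [hP0]; exact hu) (by rw [hPl]; exact hx) ?_ ?_ ?_ ?_ ?_,
    ?_⟩
  · intro y hy1 hy2
    obtain ⟨h, h'⟩ := hmeet y hy1 hy2
    exact ⟨by rw [hm, h]; rfl, by rw [hP0]; exact h'⟩
  · intro k hk0 hkl
    exact hinn _ (hPs k hkl) (hPt k hk0)
  · intro a b hab
    exact he12 _ ⟨a, rfl⟩ ⟨b, hab.symm⟩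
  · intro a b hab
    exact hep1 _ ⟨a, rfl⟩ ⟨b, hab.symm⟩
  · intro a b hab
    exact hep2 _ ⟨a, rfl⟩ ⟨b, hab.symm⟩
  · intro e he
    rcases he with (he | he) | he
    · exact Or.inl he
    · exact Or.inr (Or.inl he)
    · exact Or.inr (Or.inr he)

/-- Lollipop attached to an unbalanced circuit. -/
lemma sc_of_lol {u0 u x : V} {c p c2 : List (E × Bool)} {S : Set E} (h1 : G.LC u0 c)
    (hs1 : G.sg c ≠ 1) (hu : u ∈ c.map G.src)
    (hS : ∀ e ∈ S, e ∉ c.map Prod.fst)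
    (hL : G.Lol {y | y ∈ c.map G.src} S u p c2 x) :
    ∃ C : SignedCircuit G, ∀ e ∈ C.edges, e ∈ c.map Prod.fst ∨ e ∈ S := by
  obtain ⟨wp, wc, ne, nd, ed, inS, offX⟩ := hL
  rw [List.map_append, List.nodup_append] at nd ed
  obtain ⟨nd1, nd2, nd3⟩ := nd
  obtain ⟨ed1, ed2, ed3⟩ := ed
  have h2 : G.LC x c2 := ⟨wc, ne, nd2, ed2⟩
  have hSp : ∀ e ∈ p.map Prod.fst, e ∈ S := by
    intro e he
    obtain ⟨d, hd, rfl⟩ := List.mem_map.mp he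
    exact inS d (by simp [hd])
  have hSc : ∀ e ∈ c2.map Prod.fst, e ∈ S := by
    intro e he
    obtain ⟨d, hd, rfl⟩ := List.mem_map.mp he
    exact inS d (by simp [hd])
  have hXp : ∀ y ∈ p.map G.tgt, y ∉ c.map G.src := by
    intro e he
    obtain ⟨d, hd, rfl⟩ := List.mem_map.mp he
    exact offX d (by simp [hd])
  have hXc : ∀ y ∈ c2.map G.src, y ∉ c.map G.src := by
    intro e he
    rw [← h2.perm.mem_iff] at he
    obtain ⟨d, hd, rfl⟩ := List.mem_map.mp he
    exact offX d (by simp [hd])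
  by_cases hb : G.sg c2 = 1
  · obtain ⟨C, hC⟩ := exists_bal h2 hb
    exact ⟨C, fun e he => Or.inr (hSc e (hC e he))⟩
  · have key : ∃ C : SignedCircuit G, ∀ e ∈ C.edges,
      e ∈ c.map Prod.fst ∨ e ∈ c2.map Prod.fst ∨ e ∈ p.map Prod.fst := by
      refine exists_bic h1 h2 hs1 hb hu wp ?_ ed1 ?_ ?_ ?_ ?_ ?_
      · rw [List.nodup_append]
        refine ⟨nd1, by simp, ?_⟩
        intro a ha b hb
        simp at hb
        subst hb
        exact nd3 a ha b h2.mem_start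
      · intro y hy1 hy2
        exact absurd hy1 (hXc y hy2)
      · intro y hy1 hy2
        exact ⟨hXp y hy2, fun h => nd3 y hy1 y h rfl⟩
      · intro e he he2
        exact hS e (hSc e he2) he
      · intro e he he2
        exact hS e (hSp e he) he2
      · intro e he he2
        exact ed3 e he e he2 rfl
    obtain ⟨C, hC⟩ := key
    refine ⟨C, fun e he => ?_⟩
    rcases hC e he with h | h | h
    · exact Or.inl h
    · exact Or.inr (hSc e h)
    · exact Or.inr (hSp e h)

/-- Ear attached to an unbalanced circuit. -/
lemma sc_of_ear {u0 u t : V} {c q : List (E × Bool)} {S : Set E} (h1 : G.LC u0 c)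
    (hs1 : G.sg c ≠ 1) (hu : u ∈ c.map G.src)
    (hS : ∀ e ∈ S, e ∉ c.map Prod.fst)
    (hL : G.Ear {y | y ∈ c.map G.src} S u q t) :
    ∃ C : SignedCircuit G, ∀ e ∈ C.edges, e ∈ c.map Prod.fst ∨ e ∈ S := by
  obtain ⟨ne, wq, tX, nd, ed, inS, offX⟩ := hL
  have hSq : ∀ e ∈ q.map Prod.fst, e ∈ S := by
    intro e he
    obtain ⟨d, hd, rfl⟩ := List.mem_map.mp he
    exact inS d hd
  obtain ⟨q0, qs, rfl⟩ := List.exists_cons_of_ne_nil ne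
  have hq0 : G.src q0 = u := wq.1
  set q := q0 :: qs with hq
  have hsrcq : ∀ y ∈ q.map G.src, y ∈ c.map G.src → y = u := by
    intro y hy hyc
    rcases List.mem_cons.mp hy with h | h
    · rw [h, hq0]
    · exact absurd hyc (offX y h)
  by_cases hut : u = t
  · subst hut
    have h2 : G.LC u q := ⟨wq, ne, nd, ed⟩
    by_cases hb : G.sg q = 1
    · obtain ⟨C, hC⟩ := exists_bal h2 hb
      exact ⟨C, fun e he => Or.inr (hSq e (hC e he))⟩
    · obtain ⟨C, hC⟩ := exists_bic (p := []) h1 h2 hs1 hb hu rfl (by simp) (by simp)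
        (fun y hy hy2 => ⟨rfl, hsrcq y hy2 hy⟩) (by simp) (fun e he he2 => hS e (hSq e he2) he)
        (by simp) (by simp)
      refine ⟨C, fun e he => ?_⟩
      rcases hC e he with h | h | h
      · exact Or.inl h
      · exact Or.inr (hSq e h)
      · simp at h
  · obtain ⟨dc, bc, hc', hdc, hperm⟩ := h1.rot hu
    have ht : t ∈ (dc :: bc).map G.src := (hperm.map _).mem_iff.mpr tX
    obtain ⟨a, d, b, hab, hd, ha, hb⟩ := isW_split hc'.walk ht
    rw [hab] at hc' hperm
    have hcs : ∀ y ∈ (a ++ d :: b).map G.src, y ∈ c.map G.src :=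
      fun y hy => (hperm.map _).mem_iff.mp hy
    have hce : ∀ y ∈ (a ++ d :: b).map Prod.fst, y ∈ c.map Prod.fst :=
      fun y hy => (hperm.map _).mem_iff.mp hy
    have hsg : G.sg a * G.sg (d :: b) = -1 := by
      rw [← sg_append, sg_perm hperm]
      exact (sg_cases c).resolve_left hs1
    have hnd := hc'.nd
    have hed := hc'.edn
    rw [List.map_append, List.nodup_append] at hnd hed
    obtain ⟨nd1, nd2, nd3⟩ := hnd
    obtain ⟨ed1, ed2, ed3⟩ := hed
    have hane : a ≠ [] := by
      rintro rfl
      exact hut ha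
    have hua : u ∈ a.map G.src := by
      cases a with
      | nil => exact absurd rfl hane
      | cons x xs => simp [← ha.1]
    by_cases hbal : G.sg (q ++ d :: b) = 1
    · have h2 : G.LC u (q ++ d :: b) := by
        refine ⟨isW_append.mpr ⟨_, wq, hb⟩, by simp, ?_, ?_⟩
        · rw [List.map_append, List.nodup_append]
          refine ⟨nd, nd2, ?_⟩
          rintro y hy _ hy2 rfl
          have := hsrcq y hy (hcs y (by rw [List.map_append]; exact List.mem_append_right _ hy2))
          subst this
          exact nd3 y hua y hy2 rfl
        · rw [List.map_append, List.nodup_append]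
          refine ⟨ed, ed2, ?_⟩
          rintro y hy _ hy2 rfl
          exact hS y (hSq y hy) (hce y (by rw [List.map_append]; exact List.mem_append_right _ hy2))
      obtain ⟨C, hC⟩ := exists_bal h2 hbal
      refine ⟨C, fun e he => ?_⟩
      have := hC e he
      rw [List.map_append, List.mem_append] at this
      rcases this with h | h
      · exact Or.inr (hSq e h)
      · exact Or.inl (hce e (by rw [List.map_append]; exact List.mem_append_right _ h))
    · have hbal2 : G.sg (a ++ rvl q) = 1 := by
        rw [sg_append, sg_rvl]
        rw [sg_append] at hbal
        rcases sg_cases (G := G) a with h | h <;> rcases sg_cases (G := G) q with h' | h' <;>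
          rcases sg_cases (G := G) (d :: b) with hz | hz <;> rw [h, hz] at hsg <;>
          rw [h', hz] at hbal <;> rw [h, h'] <;> norm_num at * 
      have heq := isW_eq wq
      have htq : q.map G.tgt = qs.map G.src ++ [t] := by
        have : u :: q.map G.tgt = u :: (qs.map G.src ++ [t]) := by
          rw [← heq, hq, List.map_cons, hq0]; rfl
        exact (List.cons.inj this).2
      have htqs : t ∉ qs.map G.src := fun h => offX t h tX
      have h2 : G.LC u (a ++ rvl q) := by
        refine ⟨isW_append.mpr ⟨_, ha, isW_rvl wq⟩, by simp [hane], ?_, ?_⟩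
        · rw [List.map_append, List.nodup_append, rvl_src, List.nodup_reverse, htq]
          refine ⟨nd1, ?_, ?_⟩
          · rw [List.nodup_append]
            refine ⟨(List.nodup_cons.mp nd).2, by simp, ?_⟩
            rintro y hy _ hy2 rfl
            simp at hy2
            subst hy2
            exact htqs hy
          · rintro y hy _ hy2 rfl
            rw [List.mem_reverse, List.mem_append] at hy2
            rcases hy2 with h | h
            · exact offX y h (hcs y (by rw [List.map_append]; exact List.mem_append_left _ hy))
            · simp at h
              subst h
              exact nd3 y hy y (by simp [hd]) rfl
        · rw [List.map_append, List.nodup_append, rvl_fst, List.nodup_reverse]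
          refine ⟨ed1, ed, ?_⟩
          rintro y hy _ hy2 rfl
          rw [List.mem_reverse] at hy2
          exact hS y (hSq y hy2) (hce y (by rw [List.map_append]; exact List.mem_append_left _ hy))
      obtain ⟨C, hC⟩ := exists_bal h2 hbal2
      refine ⟨C, fun e he => ?_⟩
      have := hC e he
      rw [List.map_append, List.mem_append, rvl_fst, List.mem_reverse] at this
      rcases this with h | h
      · exact Or.inl (hce e (by rw [List.map_append]; exact List.mem_append_left _ h))
      · exact Or.inr (hSq e h)

/-! Flows -/

/-- sign of a half-edge in an orientation -/
def sig (O : SOrientation G) (d : E × Bool) : ℤ := if O.dir d.1 d.2 = true then 1 else -1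

lemma sig_ne (O : SOrientation G) (d : E × Bool) : sig O d ≠ 0 := by
  unfold sig; split_ifs <;> norm_num
lemma sig_sq (O : SOrientation G) (d : E × Bool) : sig O d * sig O d = 1 := by
  unfold sig; split_ifs <;> norm_num

lemma sig_rv (O : SOrientation G) (d : E × Bool) : sig O (rv d) = - (G.s1 d * sig O d) := by
  rcases d with ⟨e, b⟩
  have h := O.compat e
  cases b <;> cases h1 : O.dir e false <;> cases h2 : O.dir e true <;>
    simp [h1, h2] at h <;> simp [sig, rv, s1, h, h1, h2]

/-- net inflow at a vertex -/
def bd [Fintype E] [DecidableEq V] (O : SOrientation G) (f : E → ℤ) (v : V) : ℤ :=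
  ∑ q : E × Bool, if G.src q = v then sig O q * f q.1 else 0

lemma isFlow_iff [Fintype E] [DecidableEq V] (O : SOrientation G) (f : E → ℤ) :
    IsFlow O f ↔ ∀ v, bd O f v = 0 := by
  unfold IsFlow
  refine forall_congr' fun v => ?_
  rw [← sub_eq_zero]
  have : bd O f v = (∑ e : E, ∑ i : Bool, if G.ends e i = v ∧ O.dir e i = true then f e else 0)
      - ∑ e : E, ∑ i : Bool, if G.ends e i = v ∧ O.dir e i = false then f e else 0 := by
    unfold bd
    rw [Fintype.sum_prod_type, ← Finset.sum_sub_distrib]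
    refine Finset.sum_congr rfl fun e _ => ?_
    rw [← Finset.sum_sub_distrib]
    refine Finset.sum_congr rfl fun i _ => ?_
    by_cases h : G.ends e i = v <;> cases h2 : O.dir e i <;> simp [src, sig, h, h2]
  rw [this]

lemma bd_lin [Fintype E] [DecidableEq V] (O : SOrientation G) (f g : E → ℤ) (a b : ℤ) (v : V) :
    bd O (fun e => a * f e + b * g e) v = a * bd O f v + b * bd O g v := by
  unfold bd
  rw [Finset.mul_sum, Finset.mul_sum, ← Finset.sum_add_distrib]
  refine Finset.sum_congr rfl fun q _ => ?_
  split_ifs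
  · ring
  · ring

lemma bd_add [Fintype E] [DecidableEq V] (O : SOrientation G) (f g : E → ℤ) (v : V) :
    bd O (f + g) v = bd O f v + bd O g v := by
  have := bd_lin O f g 1 1 v
  simpa [Pi.add_def] using this

lemma bd_single [Fintype E] [DecidableEq V] [DecidableEq E] (O : SOrientation G) (d : E × Bool)
    (a : ℤ) (v : V) :
    bd O (Pi.single d.1 a) v =
      (if G.src d = v then sig O d * a else 0) + (if G.tgt d = v then sig O (rv d) * a else 0) := by
  unfold bd
  rw [Finset.sum_eq_add d (rv d) (rv_ne d).symm]
  · simp [rv_fst, src_rv]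
  · intro q _ hq
    have : q.1 ≠ d.1 := by
      intro h
      rcases eq_or_rv h with h | h
      · exact hq.1 h
      · exact hq.2 h
    simp [Pi.single_eq_of_ne this]
  · simp
  · simp

/-- flow along a walk -/
def wf [DecidableEq E] (O : SOrientation G) : List (E × Bool) → ℤ → E → ℤ
  | [], _ => 0
  | d :: l, c => Pi.single d.1 (-(c * sig O d)) + wf O l (c * G.s1 d)

lemma bd_wf [Fintype E] [DecidableEq V] [DecidableEq E] (O : SOrientation G) {u w : V}
    {l : List (E × Bool)} (h : G.IsW u l w) (c : ℤ) (v : V) :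
    bd O (wf O l c) v = (if w = v then c * G.sg l else 0) - (if u = v then c else 0) := by
  induction l generalizing u c with
  | nil =>
    obtain rfl : u = w := h
    simp [wf, bd, sg_nil]
  | cons d l ih =>
    obtain ⟨h1, h2⟩ := h
    simp only [wf]
    rw [bd_add, ih h2, bd_single, h1, sg_cons, sig_rv]
    have e1 : sig O d * -(c * sig O d) = -c := by
      linear_combination (-c) * sig_sq O d
    have e2 : -(G.s1 d * sig O d) * -(c * sig O d) = c * G.s1 d := by
      linear_combination (c * G.s1 d) * sig_sq O d
    rw [e1, e2]
    split_ifs <;> ring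

lemma wf_zero [DecidableEq E] (O : SOrientation G) {l : List (E × Bool)} (c : ℤ) {e : E}
    (he : e ∉ l.map Prod.fst) : wf O l c e = 0 := by
  induction l generalizing c with
  | nil => rfl
  | cons d l ih =>
    simp only [List.map_cons, List.mem_cons, not_or] at he
    simp [wf, ih _ he.2, Pi.single_eq_of_ne he.1]

lemma wf_ne [DecidableEq E] (O : SOrientation G) {l : List (E × Bool)} (c : ℤ) (hc : c ≠ 0) {e : E}
    (he : e ∈ l.map Prod.fst) (hnd : (l.map Prod.fst).Nodup) : wf O l c e ≠ 0 := by
  induction l generalizing c with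
  | nil => simp at he
  | cons d l ih =>
    rw [List.map_cons, List.nodup_cons] at hnd
    simp only [wf, Pi.add_apply]
    rcases List.mem_cons.mp he with h | h
    · subst h
      rw [wf_zero O _ hnd.1]
      simp [hc, sig_ne]
    · have hne : e ≠ d.1 := fun h' => hnd.1 (h' ▸ h)
      rw [Pi.single_eq_of_ne hne, zero_add]
      refine ih _ (mul_ne_zero hc ?_) h hnd.2
      unfold s1; split_ifs <;> norm_num

lemma wf_iff [DecidableEq E] (O : SOrientation G) {l : List (E × Bool)} (c : ℤ) (hc : c ≠ 0) {e : E}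
    (hnd : (l.map Prod.fst).Nodup) : wf O l c e ≠ 0 ↔ e ∈ l.map Prod.fst := by
  constructor
  · intro h
    by_contra h'
    exact h (wf_zero O c h')
  · exact fun h => wf_ne O c hc h hnd

lemma sc_flow [Fintype E] [DecidableEq V] [DecidableEq E] (O : SOrientation G)
    (C : SignedCircuit G) :
    ∃ f : E → ℤ, (∀ v, bd O f v = 0) ∧ ∀ e, f e ≠ 0 ↔ e ∈ C.edges := by
  cases C with
  | balanced C hb =>
    have h := circuit_LC C
    refine ⟨wf O C.toL 1, fun v => ?_, fun e => ?_⟩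
    · rw [bd_wf O h.walk, (sg_circuit C).mpr hb]; simp
    · rw [wf_iff O 1 one_ne_zero h.edn, mem_toL_fst]; rfl
  | bicircuit C₁ C₂ P h₁ h₂ hstart hend hmeet hpathint hedisj hpe₁ hpe₂ =>
    have e₁ := circuit_LC C₁
    have e₂ := circuit_LC C₂
    obtain ⟨d1, b1, r1, -, p1⟩ := e₁.rot ((mem_toL_src _ _).mpr hstart)
    obtain ⟨d2, b2, r2, -, p2⟩ := e₂.rot ((mem_toL_src _ _).mpr hend)
    set l1 := d1 :: b1
    set l2 := d2 :: b2
    have s1 : G.sg l1 = -1 := by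
      rw [sg_perm p1]
      exact (sg_cases _).resolve_left (fun h => h₁ ((sg_circuit _).mp h))
    have s2 : G.sg l2 = -1 := by
      rw [sg_perm p2]
      exact (sg_cases _).resolve_left (fun h => h₂ ((sg_circuit _).mp h))
    have m1 : ∀ e, e ∈ l1.map Prod.fst ↔ e ∈ Set.range C₁.edge := fun e => by
      rw [(p1.map _).mem_iff, mem_toL_fst]
    have m2 : ∀ e, e ∈ l2.map Prod.fst ↔ e ∈ Set.range C₂.edge := fun e => by
      rw [(p2.map _).mem_iff, mem_toL_fst]
    have m3 := mem_ptoL_fst P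
    have hsP : G.sg P.toL ≠ 0 := by
      rcases sg_cases (G := G) P.toL with h | h <;> rw [h] <;> norm_num
    refine ⟨wf O l1 (-1) + wf O P.toL 2 + wf O l2 (G.sg P.toL), fun v => ?_, fun e => ?_⟩
    · rw [bd_add, bd_add, bd_wf O r1.walk, bd_wf O (gpath_isW P), bd_wf O r2.walk, s1, s2]
      split_ifs <;> ring
    · have k1 := wf_iff O (-1) (by norm_num) (e := e) r1.edn
      have k2 := wf_iff O (G.sg P.toL) hsP (e := e) r2.edn
      have k3 := wf_iff O 2 (by norm_num) (e := e) (gpath_ed P)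
      rw [m1] at k1
      rw [m2] at k2
      rw [m3] at k3
      change _ ↔ (e ∈ Set.range C₁.edge ∨ e ∈ Set.range C₂.edge) ∨ e ∈ Set.range P.edge
      simp only [Pi.add_apply]
      by_cases q1 : e ∈ Set.range C₁.edge
      · have q2 : e ∉ Set.range C₂.edge := by
          rintro ⟨b, hb⟩; obtain ⟨a, ha⟩ := q1
          exact hedisj a b (ha.trans hb.symm)
        have q3 : e ∉ Set.range P.edge := by
          rintro ⟨b, hb⟩; obtain ⟨a, ha⟩ := q1
          exact hpe₁ b a (hb.trans ha.symm)
        have z2 := not_not.mp (mt k2.mp q2)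
        have z3 := not_not.mp (mt k3.mp q3)
        rw [z2, z3]
        simpa [q1, q2, q3] using k1.mpr q1
      · have z1 := not_not.mp (mt k1.mp q1)
        by_cases q2 : e ∈ Set.range C₂.edge
        · have q3 : e ∉ Set.range P.edge := by
            rintro ⟨b, hb⟩; obtain ⟨a, ha⟩ := q2
            exact hpe₂ b a (hb.trans ha.symm)
          have z3 := not_not.mp (mt k3.mp q3)
          rw [z1, z3]
          have := k2.mpr q2
          simp only [zero_add]
          tauto
        · have z2 := not_not.mp (mt k2.mp q2)
          rw [z1, z2, zero_add, add_zero]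
          tauto

lemma sc_edges_nonempty (C : SignedCircuit G) : ∃ e, e ∈ C.edges := by
  cases C with
  | balanced C hb => exact ⟨C.edge 0, 0, rfl⟩
  | bicircuit C₁ C₂ P h₁ h₂ hstart hend hmeet hpathint hedisj hpe₁ hpe₂ =>
    exact ⟨C₁.edge 0, Or.inl (Or.inl ⟨0, rfl⟩)⟩

lemma flow_deg [Fintype E] [DecidableEq V] (O : SOrientation G) {f : E → ℤ}
    (hf : ∀ v, bd O f v = 0) (d : E × Bool) (hd : f d.1 ≠ 0) :
    ∃ d', d' ≠ rv d ∧ G.src d' = G.tgt d ∧ f d'.1 ≠ 0 := by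
  by_contra H
  push Not at H
  have h := hf (G.tgt d)
  unfold bd at h
  rw [Finset.sum_eq_single (rv d)] at h
  · simp [src_rv, rv_fst, sig_ne, hd] at h
  · intro q _ hq
    split_ifs with hs
    · rw [H q hq hs, mul_zero]
    · rfl
  · simp

lemma third [Fintype E] [DecidableEq V] (O : SOrientation G) {f : E → ℤ}
    (hf : ∀ v, bd O f v = 0) {u : V} {c : List (E × Bool)} (hc : G.LC u c) (hs : G.sg c ≠ 1)
    (hsupp : ∀ e ∈ c.map Prod.fst, f e ≠ 0) :
    ∃ q : E × Bool, G.src q ∈ c.map G.src ∧ f q.1 ≠ 0 ∧ q.1 ∉ c.map Prod.fst := by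
  by_contra H
  push Not at H
  have srcinj : ∀ a ∈ c, ∀ b ∈ c, G.src a = G.src b → a = b :=
    fun a ha b hb h => List.inj_on_of_nodup_map hc.nd ha hb h
  have tgtinj : ∀ a ∈ c, ∀ b ∈ c, G.tgt a = G.tgt b → a = b :=
    fun a ha b hb h => List.inj_on_of_nodup_map (hc.perm.nodup_iff.mpr hc.nd) ha hb h
  have edinj : ∀ a ∈ c, ∀ b ∈ c, a.1 = b.1 → a = b :=
    fun a ha b hb h => List.inj_on_of_nodup_map hc.edn ha hb h
  have nxt : ∀ d ∈ c, ∃ d' ∈ c, G.src d' = G.tgt d ∧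
      sig O d' * f d'.1 = G.s1 d * (sig O d * f d.1) := by
    intro d hd
    obtain ⟨d', hd', hst⟩ : ∃ d' ∈ c, G.src d' = G.tgt d := by
      have : G.tgt d ∈ c.map G.src := hc.perm.mem_iff.mp (List.mem_map_of_mem hd)
      exact List.mem_map.mp this
    refine ⟨d', hd', hst, ?_⟩
    have h := hf (G.tgt d)
    unfold bd at h
    rw [Finset.sum_eq_add (rv d) d'] at h
    · simp only [src_rv, rv_fst, hst, if_true, sig_rv] at h
      linarith
    · intro h'
      have := edinj d hd d' hd' (by rw [← h', rv_fst])
      exact rv_ne d (h'.trans this.symm)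
    · intro q _ hq
      split_ifs with hsq
      · by_contra h0
        have hq0 : f q.1 ≠ 0 := right_ne_zero_of_mul h0
        have hqm := H q (by rw [hsq, ← hst]; exact List.mem_map_of_mem hd') hq0
        obtain ⟨q', hq', hqe⟩ := List.mem_map.mp hqm
        rcases eq_or_rv hqe.symm with h1 | h1
        · subst h1
          exact hq.2 (srcinj q hq' d' hd' (hsq.trans hst.symm))
        · rw [h1, src_rv] at hsq
          exact hq.1 (by rw [h1, tgtinj q' hq' d hd hsq])
      · rfl
    · simp
    · simp
  have main : ∀ (l : List (E × Bool)) (v : V), (∀ d ∈ l, d ∈ c) → G.IsW v l u →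
      ∀ q ∈ c, G.src q = v → ∀ q0 ∈ c, G.src q0 = u →
      sig O q0 * f q0.1 = G.sg l * (sig O q * f q.1) := by
    intro l
    induction l with
    | nil =>
      intro v _ hw q hq hqv q0 hq0 hq0u
      obtain rfl : v = u := hw
      rw [srcinj q hq q0 hq0 (hqv.trans hq0u.symm), sg_nil, one_mul]
    | cons d l ih =>
      intro v hl hw q hq hqv q0 hq0 hq0u
      have hd := hl d (by simp)
      obtain rfl := srcinj q hq d hd (hqv.trans hw.1.symm)
      obtain ⟨d', hd', hst, hval⟩ := nxt q hd
      rw [ih _ (fun x hx => hl x (by simp [hx])) hw.2 d' hd' hst q0 hq0 hq0u, hval, sg_cons]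
      ring
  obtain ⟨q, hq, hqu⟩ := List.mem_map.mp hc.mem_start
  have h := main c u (fun _ h => h) hc.walk q hq hqu q hq hqu
  rw [(sg_cases c).resolve_left hs] at h
  have hne : sig O q * f q.1 ≠ 0 :=
    mul_ne_zero (sig_ne _ _) (hsupp _ (List.mem_map_of_mem hq))
  apply hne
  linarith

lemma sc_in_supp [Fintype E] [DecidableEq V] (O : SOrientation G) {f : E → ℤ}
    (hf : ∀ v, bd O f v = 0) (e0 : E) (he0 : f e0 ≠ 0) :
    ∃ C : SignedCircuit G, ∀ e ∈ C.edges, f e ≠ 0 := by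
  have hc : ∃ u c, G.LC u c ∧ ∀ e ∈ c.map Prod.fst, f e ≠ 0 := by
    rcases explore' (G := G) (X := ∅) (S := {e | f e ≠ 0})
      (fun d hd _ => flow_deg O hf d hd) (e0, true) he0 with ⟨l, t, h⟩ | ⟨p, c, x, h⟩
    · exact absurd h.tX (by simp)
    · refine ⟨x, c, ⟨h.wc, h.ne, ?_, ?_⟩, ?_⟩
      · have := h.nd
        rw [List.map_append] at this
        exact (List.nodup_append.mp this).2.1
      · have := h.ed
        rw [List.map_append] at this
        exact (List.nodup_append.mp this).2.1
      · intro e he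
        obtain ⟨d, hd, rfl⟩ := List.mem_map.mp he
        exact h.inS d (by simp [hd])
  obtain ⟨u, c, hc, hsupp⟩ := hc
  by_cases hs : G.sg c = 1
  · obtain ⟨C, hC⟩ := exists_bal hc hs
    exact ⟨C, fun e he => hsupp e (hC e he)⟩
  obtain ⟨q, hq1, hq2, hq3⟩ := third O hf hc hs hsupp
  have hends : ∀ d : E × Bool, d.1 ∈ c.map Prod.fst → G.src d ∈ c.map G.src := by
    intro d hd
    obtain ⟨d', hd', he⟩ := List.mem_map.mp hd
    rcases eq_or_rv he.symm with h | h
    · subst h; exact List.mem_map_of_mem hd'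
    · subst h; rw [src_rv]; exact hc.perm.mem_iff.mp (List.mem_map_of_mem hd')
  have key := explore' (G := G) (X := {y | y ∈ c.map G.src})
      (S := {e | f e ≠ 0 ∧ e ∉ c.map Prod.fst}) (by
        intro d hd hX
        obtain ⟨d', h1, h2, h3⟩ := flow_deg O hf d hd.1
        refine ⟨d', h1, h2, h3, fun h => hX ?_⟩
        rw [← h2]
        exact hends d' h) q ⟨hq2, hq3⟩
  have fin : ∃ C : SignedCircuit G, ∀ e ∈ C.edges, e ∈ c.map Prod.fst ∨
      e ∈ {e | f e ≠ 0 ∧ e ∉ c.map Prod.fst} := by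
    rcases key with ⟨l, t, h⟩ | ⟨p, c', x, h⟩
    · exact sc_of_ear hc hs hq1 (fun e he => he.2) h
    · exact sc_of_lol hc hs hq1 (fun e he => he.2) h
  obtain ⟨C, hC⟩ := fin
  refine ⟨C, fun e he => ?_⟩
  rcases hC e he with h | h
  · exact hsupp e h
  · exact h.1

lemma forward [Fintype E] [DecidableEq V] [DecidableEq E] (O : SOrientation G) (e : E) :
    ∀ (n : ℕ) (f : E → ℤ), (∀ v, bd O f v = 0) → f e ≠ 0 →
      (Finset.univ.filter (fun x => f x ≠ 0)).card ≤ n →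
      ∃ C : SignedCircuit G, e ∈ C.edges := by
  intro n
  induction n with
  | zero =>
    intro f _ he hn
    have : e ∈ Finset.univ.filter (fun x => f x ≠ 0) := by simp [he]
    have := Finset.card_pos.mpr ⟨e, this⟩
    omega
  | succ n ih =>
    intro f hf he hn
    obtain ⟨C, hC⟩ := sc_in_supp O hf e he
    by_cases hm : e ∈ C.edges
    · exact ⟨C, hm⟩
    obtain ⟨g, hg, hgC⟩ := sc_flow O C
    obtain ⟨e', he'⟩ := sc_edges_nonempty C
    have hge : g e = 0 := by
      by_contra h
      exact hm ((hgC e).mp h)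
    have hge' := (hgC e').mpr he'
    refine ih (fun x => g e' * f x + (- f e') * g x) (fun v => ?_) ?_ ?_
    · rw [bd_lin, hf, hg]; simp
    · simp [hge, hge', he]
    · refine Nat.le_of_lt_succ (lt_of_lt_of_le (Finset.card_lt_card ?_) hn)
      rw [Finset.ssubset_iff_of_subset]
      · exact ⟨e', by simp [hC e' he'], by simp; ring⟩
      · intro x hx
        simp only [Finset.mem_filter, Finset.mem_univ, true_and] at hx ⊢
        intro h0
        apply hx
        have : g x = 0 := by
          by_contra h
          exact hC x ((hgC x).mp h) h0
        simp [h0, this]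

lemma backward [Fintype E] [DecidableEq V] [DecidableEq E] (O : SOrientation G)
    (h : ∀ e : E, ∃ f : E → ℤ, (∀ v, bd O f v = 0) ∧ f e ≠ 0) (s : Finset E) :
    ∃ f : E → ℤ, (∀ v, bd O f v = 0) ∧ ∀ e ∈ s, f e ≠ 0 := by
  induction s using Finset.induction_on with
  | empty => exact ⟨0, fun v => by simp [bd], by simp⟩
  | insert e s _ ih =>
    obtain ⟨f, hf, hfs⟩ := ih
    obtain ⟨g, hg, hge⟩ := h e
    -- choose a multiplier larger than all values of `g`
    obtain ⟨N, hN⟩ : ∃ N : ℤ, ∀ x, |g x| < N :=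
      ⟨∑ x, |g x| + 1, fun x => Int.lt_add_one_of_le
        (Finset.single_le_sum (f := fun x => |g x|) (fun i _ => abs_nonneg _) (Finset.mem_univ x))⟩
    have hNpos : 0 < N := lt_of_le_of_lt (abs_nonneg _) (hN e)
    refine ⟨fun x => N * f x + 1 * g x, fun v => by rw [bd_lin, hf, hg]; simp, ?_⟩
    have key : ∀ x, (f x ≠ 0 ∨ g x ≠ 0) → N * f x + 1 * g x ≠ 0 := by
      intro x hx h0
      by_cases hfx : f x = 0
      · rw [hfx] at h0
        simp at h0
        rcases hx with h | h
        · exact h hfx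
        · exact h h0
      · have h1 : g x = N * (- f x) := by linarith
        have h2 : |g x| = N * |f x| := by rw [h1, abs_mul, abs_neg, abs_of_pos hNpos]
        have h3 : 1 ≤ |f x| := Int.one_le_abs hfx
        have h4 := hN x
        nlinarith
    intro x hx
    rcases Finset.mem_insert.mp hx with h | h
    · subst h; exact key _ (Or.inr hge)
    · exact key _ (Or.inl (hfs x h))

end SignedGraph
end FlowProof

/-- A signed graph admits a nowhere-zero integer flow if and only if every
edge belongs to a signed circuit (a balanced circuit or an unbalanced
bicircuit). -/
theorem hasNZFlow_iff_every_edge_in_signedCircuit {V E : Type} [Fintype E]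
    [DecidableEq V] (G : SignedGraph V E) :
    HasNZFlow G ↔ ∀ e : E, ∃ C : SignedCircuit G, e ∈ C.edges := by

  classical
  constructor
  · rintro ⟨O, f, hf, hne⟩ e
    exact SignedGraph.forward O e _ f ((SignedGraph.isFlow_iff O f).mp hf) (hne e) le_rfl
  · intro h
    let O : SOrientation G := ⟨fun e i => xor (G.sign e) true && !i || i, by
      intro e; cases G.sign e <;> rfl⟩
    obtain ⟨f, hf, hne⟩ := SignedGraph.backward O (fun e => by
      obtain ⟨C, hC⟩ := h e
      obtain ⟨f, hf, hfe⟩ := SignedGraph.sc_flow O C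
      exact ⟨f, hf, (hfe e).mpr hC⟩) Finset.univ
    exact ⟨O, f, (SignedGraph.isFlow_iff O f).mpr hf, fun e => hne e (Finset.mem_univ e)⟩
end

section
/- If a signed graph G admits a nowhere-zero integer flow φ, then G has a signed circuit cover in which each edge e of G belongs to at most 2|φ(e)| of the signed circuits. -/
variable {V E : Type}

namespace CoverAux


/-- Reverse of a dart. -/
def rv (p : E × Bool) : E × Bool := (p.1, !p.2)

/-- Initial vertex of a dart. -/
def hv (G : SignedGraph V E) (p : E × Bool) : V := G.ends p.1 p.2

/-- Direction of the initial half of a dart. -/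
def hd {G : SignedGraph V E} (O : SOrientation G) (p : E × Bool) : Bool := O.dir p.1 p.2

/-- Consistent succession of darts. -/
def Step {G : SignedGraph V E} (O : SOrientation G) (p q : E × Bool) : Prop :=
  hv G (rv p) = hv G q ∧ hd O (rv p) ≠ hd O q

/-- Closed consistent walk of length `n`, as a periodic sequence. -/
structure CW {G : SignedGraph V E} (O : SOrientation G) (n : ℕ) (w : ℕ → E × Bool) : Prop where
  pos : 0 < n
  per : ∀ t, w (t + n) = w t
  step : ∀ t, Step O (w t) (w (t + 1))

open Classical in
/-- multiplicity of an edge -/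
noncomputable def mult (n : ℕ) (w : ℕ → E × Bool) (x : E) : ℕ :=
  ((Finset.range n).filter fun t => (w t).1 = x).card

/-- Irreducibility. -/
structure Irr {G : SignedGraph V E} (O : SOrientation G) (n : ℕ) (w : ℕ → E × Bool) : Prop where
  typ : ∀ s t, s < t → t < s + n → hv G (w s) = hv G (w t) → hd O (w s) ≠ hd O (w t)
  cross : ∀ a s b t, a < s → s < b → b < t → t < a + n → hv G (w a) = hv G (w b) →
    hv G (w s) ≠ hv G (w t)

@[simp] lemma rv_rv (p : E × Bool) : rv (rv p) = p := by simp [rv]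

@[simp] lemma rv_fst (p : E × Bool) : (rv p).1 = p.1 := rfl

lemma Step.rev {G : SignedGraph V E} {O : SOrientation G} {p q : E × Bool} (h : Step O p q) :
    Step O (rv q) (rv p) := by
  refine ⟨?_, ?_⟩
  · rw [rv_rv]; exact h.1.symm
  · rw [rv_rv]; exact h.2.symm

lemma bool_aux {a b c : Bool} (h1 : a ≠ b) (h2 : b ≠ c) : a = c := by
  revert a b c; decide

section walk

variable {G : SignedGraph V E} {O : SOrientation G} {n : ℕ} {w : ℕ → E × Bool}

open Classical in
lemma window (hper : ∀ t, w (t + n) = w t) (s : ℕ) (x : E) :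
    ((Finset.Ico s (s + n)).filter fun t => (w t).1 = x).card = mult n w x := by
  have h := Nat.filter_Ico_card_eq_of_periodic s n (fun t => (w t).1 = x)
    (by intro t; simp [hper])
  rw [h, Nat.count_eq_card_filter_range]; rfl

lemma mkCW (u : ℕ → E × Bool) (hn : 0 < n) (h1 : ∀ i, i + 1 < n → Step O (u i) (u (i + 1)))
    (h2 : Step O (u (n - 1)) (u 0)) : CW O n (fun t => u (t % n)) := by
  refine ⟨hn, fun t => by simp, fun t => ?_⟩
  have hlt := Nat.mod_lt t hn
  rcases Nat.lt_or_ge (t % n + 1) n with h | h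
  · have : (t + 1) % n = t % n + 1 := by
      rw [Nat.add_mod]
      rcases Nat.lt_or_ge 1 n with h' | h'
      · rw [Nat.mod_eq_of_lt h', Nat.mod_eq_of_lt h]
      · omega
    simp only [this]; exact h1 _ h
  · have h3 : t % n = n - 1 := by omega
    have : (t + 1) % n = 0 := by
      have := Nat.div_add_mod t n
      have e : t + 1 = n * (t / n + 1) := by rw [Nat.mul_add]; omega
      rw [e]; simp
    simp only [this, h3]; exact h2

open Classical in
lemma mult_mod (u : ℕ → E × Bool) (x : E) :
    mult n (fun t => u (t % n)) x = mult n u x := by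
  unfold mult
  congr 1
  apply Finset.filter_congr
  intro t ht
  simp only [Nat.mod_eq_of_lt (Finset.mem_range.1 ht)]

open Classical in
lemma mult_le_of_inj (hper : ∀ t, w (t + n) = w t) (s m : ℕ) (u : ℕ → E × Bool) (k : ℕ → ℕ)
    (hk : ∀ i < m, s ≤ k i ∧ k i < s + n) (hinj : ∀ i < m, ∀ j < m, k i = k j → i = j)
    (hu : ∀ i < m, (u i).1 = (w (k i)).1) (x : E) : mult m u x ≤ mult n w x := by
  rw [← window hper s x]
  apply Finset.card_le_card_of_injOn k
  · intro i hi
    simp only [Finset.coe_filter, Finset.mem_range, Set.mem_ofPred_eq, Finset.mem_Ico] at hi ⊢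
    exact ⟨hk i hi.1, by rw [← hu i hi.1]; exact hi.2⟩
  · intro i hi j hj h
    simp only [Finset.coe_filter, Finset.mem_range, Set.mem_ofPred_eq] at hi hj
    exact hinj i hi.1 j hj.1 h

/-- A shortest closed walk is irreducible. -/
lemma irr_of_shortest (hw : CW O n w)
    (hmin : ∀ m < n, ∀ u, CW O m u → ¬ ∀ x, mult m u x ≤ mult n w x) : Irr O n w := by
  have typ : ∀ s t, s < t → t < s + n → hv G (w s) = hv G (w t) → hd O (w s) ≠ hd O (w t) := by
    intro s t hst htn hv1 hd1
    refine hmin (t - s) (by omega) _ (mkCW (fun i => w (s + i)) (by omega) ?_ ?_) ?_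
    · intro i hi; exact hw.step (s + i)
    · have := hw.step (t - 1)
      rw [show t - 1 + 1 = t by omega] at this
      simp only [show s + (t - s - 1) = t - 1 by omega, Nat.add_zero]
      exact ⟨this.1.trans hv1.symm, by rw [hd1]; exact this.2⟩
    · intro x
      rw [mult_mod (fun i => w (s + i))]
      exact mult_le_of_inj hw.per s _ _ (fun i => s + i) (by intro i hi; omega)
        (by intro i hi j hj; omega) (by intro i hi; rfl) x
  refine ⟨typ, ?_⟩
  intro a s b t has hsb hbt hta hab hst
  have ta := typ a b (by omega) (by omega) hab
  have ts := typ s t (by omega) (by omega) hst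
  let k : ℕ → ℕ := fun i => if i < s - a then a + i else t - 1 - (i - (s - a))
  let u : ℕ → E × Bool := fun i => if i < s - a then w (k i) else rv (w (k i))
  refine hmin ((s - a) + (t - b)) (by omega) _ (mkCW u (by omega) ?_ ?_) ?_
  · intro i hi
    rcases Nat.lt_trichotomy (i + 1) (s - a) with h | h | h
    · have h' : i < s - a := by omega
      simp only [u, k, h, h', if_true]
      exact hw.step (a + i)
    · have h' : i < s - a := by omega
      have h'' : ¬ (i + 1 < s - a) := by omega
      simp only [u, k, h', h'', if_true, if_false]
      rw [show t - 1 - (i + 1 - (s - a)) = t - 1 by omega, show a + i = s - 1 by omega]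
      have p := hw.step (s - 1)
      have q := (hw.step (t - 1)).rev
      rw [show s - 1 + 1 = s by omega] at p
      rw [show t - 1 + 1 = t by omega] at q
      refine ⟨p.1.trans (hst.trans ?_), ?_⟩
      · have := q.1; rw [rv_rv] at this; exact this
      · have := q.2; rw [rv_rv] at this
        have p2 := p.2
        intro hh
        rw [hh] at p2
        exact ts (bool_aux p2.symm this.symm)
    · have h' : ¬ (i < s - a) := by omega
      have h'' : ¬ (i + 1 < s - a) := by omega
      simp only [u, k, h', h'', if_false]
      have q := (hw.step (t - 1 - (i + 1 - (s - a)))).rev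
      rw [show t - 1 - (i + 1 - (s - a)) + 1 = t - 1 - (i - (s - a)) by omega] at q
      exact q
  · have h' : ¬ (s - a + (t - b) - 1 < s - a) := by omega
    have h0 : 0 < s - a := by omega
    simp only [u, k, h', h0, if_true, if_false]
    rw [show t - 1 - (s - a + (t - b) - 1 - (s - a)) = b by omega, Nat.add_zero]
    refine ⟨?_, ?_⟩
    · rw [rv_rv]; exact hab.symm
    · rw [rv_rv]; exact ta.symm
  · intro x
    rw [mult_mod u]
    refine mult_le_of_inj hw.per a _ _ k ?_ ?_ ?_ x
    · intro i hi; simp only [k]; split_ifs <;> omega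
    · intro i hi j hj; simp only [k]; split_ifs <;> omega
    · intro i hi; simp only [u]; split_ifs <;> rfl

/-- Repeated edges. -/
lemma edge_rep (hw : CW O n w) (hI : Irr O n w) {x y : ℕ} (hxy : x < y) (hyn : y < x + n)
    (he : (w x).1 = (w y).1) : x + 1 < y ∧ hv G (w (x + 1)) = hv G (w y) := by
  by_cases hh : (w x).2 = (w y).2
  · have : w x = w y := Prod.ext he hh
    exact absurd (by rw [this]) (hI.typ x y hxy hyn (by rw [this]))
  · have : w y = rv (w x) := by
      refine Prod.ext he.symm ?_
      simp only [rv]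
      cases h1 : (w x).2 <;> cases h2 : (w y).2 <;> simp_all
    have st := hw.step x
    refine ⟨?_, ?_⟩
    · by_contra hc
      have : y = x + 1 := by omega
      subst this
      exact st.2 (by rw [this])
    · rw [this]; exact st.1.symm

/-- First-return interval. -/
def Inner (G : SignedGraph V E) (w : ℕ → E × Bool) (a b : ℕ) : Prop :=
  a < b ∧ hv G (w a) = hv G (w b) ∧
    ∀ i j, a ≤ i → i < j → j < b → hv G (w i) ≠ hv G (w j)

lemma parity (hw : CW O n w) (a k : ℕ) :
    Even (Finset.univ.filter (fun i : Fin k => G.sign (w (a + i)).1 = false)).card ↔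
      hd O (w a) = hd O (w (a + k)) := by
  induction k with
  | zero => simp
  | succ k ih =>
    rw [Finset.card_filter, Fin.sum_univ_castSucc, ← Finset.card_filter]
    simp only [Fin.val_castSucc, Fin.val_last]
    rw [Nat.even_add, ih]
    have st := (hw.step (a + k)).2
    have cp := O.compat (w (a + k)).1
    have key : G.sign (w (a + k)).1 = false ↔ hd O (w (a + k)) ≠ hd O (w (a + (k + 1))) := by
      rw [← Nat.add_assoc]
      generalize hd O (w (a + k + 1)) = z at *
      unfold hd rv at *
      rw [cp]
      generalize w (a + k) = p at *
      obtain ⟨p1, p2⟩ := p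
      simp only at *
      generalize O.dir p1 = g at *
      cases p2 <;> simp only [Bool.not_true, Bool.not_false] at * <;>
      generalize g true = g1 at * <;> generalize g false = g2 at * <;>
      revert st <;> clear * - <;> revert g1 g2 z <;> decide
    by_cases hs : G.sign (w (a + k)).1 = false
    · simp only [hs, if_true]
      have h3 := key.1 hs
      revert h3
      generalize hd O (w (a + k)) = p
      generalize hd O (w (a + (k + 1))) = q
      generalize hd O (w a) = r
      revert p q r; decide
    · simp only [hs, if_false]
      have h3 := not_not.1 (fun h => hs (key.2 h))
      rw [h3]; simp

lemma exists_circuit (hw : CW O n w) (hI : Irr O n w) {a b : ℕ} (h : Inner G w a b)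
    (hb : b ≤ a + n) : ∃ C : Circuit G,
      (∀ x, x ∈ Set.range C.vtx ↔ ∃ t, a ≤ t ∧ t < b ∧ hv G (w t) = x) ∧
      (∀ x, x ∈ Set.range C.edge ↔ ∃ t, a ≤ t ∧ t < b ∧ (w t).1 = x) ∧
      (C.Balanced ↔ hd O (w a) = hd O (w b)) := by
  obtain ⟨hab, hv1, hinj⟩ := h
  obtain ⟨m, rfl⟩ : ∃ m, b = a + (m + 1) := ⟨b - a - 1, by omega⟩
  refine ⟨{ n := m
            vtx := fun i => hv G (w (a + i))
            edge := fun i => (w (a + i)).1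
            half := fun i => (w (a + i)).2
            vtx_inj := ?_
            edge_inj := ?_
            ends_src := fun i => rfl
            ends_tgt := ?_ }, ?_, ?_, ?_⟩
  · intro i j hij
    by_contra hne
    have hne' : (i : ℕ) ≠ j := fun h => hne (Fin.ext h)
    have := i.2
    have := j.2
    rcases Nat.lt_or_gt_of_ne hne' with h | h
    · exact hinj (a + i) (a + j) (by omega) (by omega) (by omega) hij
    · exact hinj (a + j) (a + i) (by omega) (by omega) (by omega) hij.symm
  · intro i j hij
    by_contra hne
    have hne' : (i : ℕ) ≠ j := fun h => hne (Fin.ext h)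
    have := i.2
    have := j.2
    rcases Nat.lt_or_gt_of_ne hne' with h | h
    · obtain ⟨h1, h2⟩ := edge_rep hw hI (x := a + i) (y := a + j) (by omega) (by omega) hij
      exact hinj _ _ (by omega) h1 (by omega) h2
    · obtain ⟨h1, h2⟩ := edge_rep hw hI (x := a + j) (y := a + i) (by omega) (by omega) hij.symm
      exact hinj _ _ (by omega) h1 (by omega) h2
  · intro i
    have st := (hw.step (a + i)).1
    refine Eq.trans st ?_
    show _ = hv G (w (a + ((i + 1 : Fin (m + 1)) : ℕ)))
    rw [Fin.val_add_one]
    split_ifs with hl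
    · subst hl; rw [Nat.add_zero]; exact hv1.symm
    · rfl
  · intro x
    constructor
    · rintro ⟨i, rfl⟩; exact ⟨a + i, by omega, by have : (i : ℕ) < m + 1 := i.2; omega, rfl⟩
    · rintro ⟨t, h1, h2, rfl⟩
      exact ⟨⟨t - a, show t - a < m + 1 by omega⟩, by simp only; rw [show a + (t - a) = t by omega]⟩
  · intro x
    constructor
    · rintro ⟨i, rfl⟩; exact ⟨a + i, by omega, by have : (i : ℕ) < m + 1 := i.2; omega, rfl⟩
    · rintro ⟨t, h1, h2, rfl⟩
      exact ⟨⟨t - a, show t - a < m + 1 by omega⟩, by simp only; rw [show a + (t - a) = t by omega]⟩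
  · exact parity hw a (m + 1)

lemma exists_path (hw : CW O n w) (hI : Irr O n w) {b c : ℕ} (hbc : b ≤ c) (hcn : c < b + n)
    (hinj : ∀ i j, b ≤ i → i < j → j ≤ c → hv G (w i) ≠ hv G (w j)) :
    ∃ P : GPath G, P.m = c - b ∧ (∀ k, P.vtx k = hv G (w (b + k))) ∧
      (∀ k, P.edge k = (w (b + k)).1) := by
  obtain ⟨m, rfl⟩ : ∃ m, c = b + m := ⟨c - b, by omega⟩
  refine ⟨{ m := m
            vtx := fun i => hv G (w (b + i))
            edge := fun i => (w (b + i)).1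
            half := fun i => (w (b + i)).2
            vtx_inj := ?_
            edge_inj := ?_
            ends_src := fun i => rfl
            ends_tgt := fun i => (hw.step (b + i)).1 }, ?_, fun k => rfl, fun k => rfl⟩
  · intro i j hij
    by_contra hne
    have hne' : (i : ℕ) ≠ j := fun h => hne (Fin.ext h)
    have := i.2
    have := j.2
    rcases Nat.lt_or_gt_of_ne hne' with h | h
    · exact hinj (b + i) (b + j) (by omega) (by omega) (by omega) hij
    · exact hinj (b + j) (b + i) (by omega) (by omega) (by omega) hij.symm
  · intro i j hij
    by_contra hne
    have hne' : (i : ℕ) ≠ j := fun h => hne (Fin.ext h)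
    have := i.2
    have := j.2
    rcases Nat.lt_or_gt_of_ne hne' with h | h
    · obtain ⟨h1, h2⟩ := edge_rep hw hI (x := b + i) (y := b + j) (by omega) (by omega) hij
      exact hinj _ _ (by omega) h1 (by omega) h2
    · obtain ⟨h1, h2⟩ := edge_rep hw hI (x := b + j) (y := b + i) (by omega) (by omega) hij.symm
      exact hinj _ _ (by omega) h1 (by omega) h2
  · simp

/-- The bicircuit obtained from two consecutive first-return intervals. -/
lemma exists_bicircuit (hw : CW O n w) (hI : Irr O n w) {a b c d : ℕ} (h1 : Inner G w a b)
    (hbc : b ≤ c) (h2 : Inner G w c d) (hda : d ≤ a + n)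
    (hinj : ∀ i j, b ≤ i → i < j → j < d → hv G (w i) ≠ hv G (w j)) :
    ∃ S : SignedCircuit G, ∀ x, x ∈ S.edges ↔ ∃ t, a ≤ t ∧ t < d ∧ (w t).1 = x := by
  have hab := h1.1
  have hcd := h2.1
  have hv1 := h1.2.1
  have hv2 := h2.2.1
  obtain ⟨C₁, vC₁, eC₁, bC₁⟩ := exists_circuit hw hI h1 (by omega)
  obtain ⟨C₂, vC₂, eC₂, bC₂⟩ := exists_circuit hw hI h2 (by omega)
  obtain ⟨P, Pm, vP, eP⟩ := exists_path hw hI hbc (by omega)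
    (fun i j hi hij hj => hinj i j hi hij (by omega))
  -- meeting of the first circuit with the rest
  have meet : ∀ s t, a ≤ s → s < b → b ≤ t → t < d → hv G (w s) = hv G (w t) →
      s = a ∧ t = b := by
    intro s t has hsb hbt htd hst
    have htb : t = b ∨ b < t := by omega
    have hsa : s = a ∨ a < s := by omega
    rcases hsa with rfl | hsa
    · refine ⟨rfl, ?_⟩
      rcases htb with h | h
      · exact h
      · exact absurd (hv1.symm.trans hst) (hinj b t le_rfl h htd)
    · rcases htb with rfl | h
      · exact absurd (hv1.trans hst.symm) (h1.2.2 a s le_rfl hsa hsb)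
      · exact absurd hst (hI.cross a s b t hsa hsb h (by omega) hv1)
  have meet' : ∀ s t, a < s → s ≤ b → b ≤ t → t < d → hv G (w s) = hv G (w t) →
      s = b ∧ t = b := by
    intro s t has hsb hbt htd hst
    rcases Nat.lt_or_ge s b with h | h
    · have := meet s t (by omega) h hbt htd hst
      omega
    · have hs : s = b := by omega
      subst hs
      refine ⟨rfl, ?_⟩
      by_contra hne
      exact hinj s t le_rfl (by omega) htd hst
  have edisj : ∀ x y, a ≤ x → x < b → b ≤ y → y < d → (w x).1 ≠ (w y).1 := by
    intro x y hax hxb hby hyd he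
    obtain ⟨h3, h4⟩ := edge_rep hw hI (x := x) (y := y) (by omega) (by omega) he
    have := meet' (x + 1) y (by omega) (by omega) hby hyd h4
    omega
  have edisj2 : ∀ x y, b ≤ x → x < c → c ≤ y → y < d → (w x).1 ≠ (w y).1 := by
    intro x y hax hxb hby hyd he
    obtain ⟨h3, h4⟩ := edge_rep hw hI (x := x) (y := y) (by omega) (by omega) he
    exact hinj (x + 1) y (by omega) h3 hyd h4
  have v0 : P.vtx 0 = hv G (w b) := by rw [vP]; simp
  have vl : P.vtx (Fin.last P.m) = hv G (w c) := by
    rw [vP, Fin.val_last, Pm, show b + (c - b) = c by omega]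
  refine ⟨SignedCircuit.bicircuit C₁ C₂ P ?_ ?_ ?_ ?_ ?_ ?_ ?_ ?_ ?_, ?_⟩
  · rw [bC₁]; exact hI.typ a b hab (by omega) hv1
  · rw [bC₂]; exact hI.typ c d hcd (by omega) hv2
  · rw [vC₁, v0]; exact ⟨a, le_rfl, hab, hv1⟩
  · rw [vC₂, vl]; exact ⟨c, le_rfl, hcd, rfl⟩
  · intro x hx1 hx2
    obtain ⟨s, hs1, hs2, hs⟩ := (vC₁ x).1 hx1
    obtain ⟨t, ht1, ht2, ht⟩ := (vC₂ x).1 hx2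
    obtain ⟨_, h4⟩ := meet s t hs1 hs2 (by omega) ht2 (hs.trans ht.symm)
    refine ⟨by omega, ?_⟩
    rw [v0, ← h4, ht]
  · intro k hk0 hkl
    have hk0' : (k : ℕ) ≠ 0 := fun h => hk0 (Fin.ext h)
    have hkl' : (k : ℕ) ≠ P.m := fun h => hkl (Fin.ext h)
    have := k.2
    rw [vP]
    constructor
    · intro hx
      obtain ⟨s, hs1, hs2, hs⟩ := (vC₁ _).1 hx
      have := meet s (b + k) hs1 hs2 (by omega) (by omega) hs
      omega
    · intro hx
      obtain ⟨t, ht1, ht2, ht⟩ := (vC₂ _).1 hx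
      exact hinj (b + k) t (by omega) (by omega) ht2 ht.symm
  · intro i j hij
    obtain ⟨s, hs1, hs2, hs⟩ := (eC₁ _).1 ⟨i, rfl⟩
    obtain ⟨t, ht1, ht2, ht⟩ := (eC₂ _).1 ⟨j, rfl⟩
    exact edisj s t hs1 hs2 (by omega) ht2 (by rw [hs, ht, hij])
  · intro i j hij
    obtain ⟨s, hs1, hs2, hs⟩ := (eC₁ _).1 ⟨j, rfl⟩
    have := i.2
    exact edisj s (b + i) hs1 hs2 (by omega) (by omega) (by rw [hs, ← eP, hij])
  · intro i j hij
    obtain ⟨t, ht1, ht2, ht⟩ := (eC₂ _).1 ⟨j, rfl⟩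
    have := i.2
    exact edisj2 (b + i) t (by omega) (by omega) ht1 ht2 (by rw [ht, ← eP, hij])
  · intro x
    show x ∈ Set.range C₁.edge ∪ Set.range C₂.edge ∪ Set.range P.edge ↔ _
    rw [Set.mem_union, Set.mem_union, eC₁, eC₂]
    constructor
    · rintro ((⟨t, h3, h4, h5⟩ | ⟨t, h3, h4, h5⟩) | ⟨k, rfl⟩)
      · exact ⟨t, h3, by omega, h5⟩
      · exact ⟨t, by omega, h4, h5⟩
      · have := k.2
        exact ⟨b + k, by omega, by omega, (eP k).symm⟩
    · rintro ⟨t, h3, h4, h5⟩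
      rcases Nat.lt_or_ge t b with h | h
      · exact Or.inl (Or.inl ⟨t, h3, h, h5⟩)
      · rcases Nat.lt_or_ge t c with h' | h'
        · refine Or.inr ⟨⟨t - b, by omega⟩, ?_⟩
          rw [eP]; simp only; rw [show b + (t - b) = t by omega, h5]
        · exact Or.inl (Or.inr ⟨t, h', h4, h5⟩)

lemma per_mul (hper : ∀ t, w (t + n) = w t) (t k : ℕ) : w (t + k * n) = w t := by
  induction k with
  | zero => simp
  | succ k ih => rw [Nat.succ_mul, ← Nat.add_assoc, hper, ih]

lemma exists_window (hper : ∀ t, w (t + n) = w t) (hn : 0 < n) (a x : ℕ) :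
    ∃ y k l, a ≤ y ∧ y < a + n ∧ y + k * n = x + l * n := by
  refine ⟨a + (x + a * n - a) % n, (x + a * n - a) / n, a, by omega, ?_, ?_⟩
  · have := Nat.mod_lt (x + a * n - a) hn; omega
  · have h1 := Nat.mod_add_div (x + a * n - a) n
    have h2 : a ≤ a * n := Nat.le_mul_of_pos_right a hn
    rw [Nat.mul_comm n] at h1
    omega

lemma inner_first (hw : CW O n w) (b : ℕ) : ∃ c d, b ≤ c ∧ Inner G w c d ∧ d ≤ b + n ∧
    ∀ i j, b ≤ i → i < j → j < d → hv G (w i) ≠ hv G (w j) := by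
  classical
  have hex : ∃ d, ∃ i, b ≤ i ∧ i < d ∧ hv G (w i) = hv G (w d) :=
    ⟨b + n, b, le_rfl, by have := hw.pos; omega, by rw [hw.per]⟩
  obtain ⟨c, hc1, hc2, hc3⟩ := Nat.find_spec hex
  have hinj : ∀ i j, b ≤ i → i < j → j < Nat.find hex → hv G (w i) ≠ hv G (w j) :=
    fun i j hi hij hj he => Nat.find_min hex hj ⟨i, hi, hij, he⟩
  refine ⟨c, Nat.find hex, hc1, ⟨hc2, hc3, fun i j hi => hinj i j (by omega)⟩, ?_, hinj⟩
  exact Nat.find_min' hex ⟨b, le_rfl, by have := hw.pos; omega, by rw [hw.per]⟩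

lemma inner_shift (hw : CW O n w) (a b : ℕ) : Inner G w a b ↔ Inner G w (a + n) (b + n) := by
  unfold Inner
  rw [hw.per, hw.per]
  refine and_congr (by omega) (and_congr Iff.rfl ?_)
  constructor
  · intro h i j hi hij hj
    have := h (i - n) (j - n) (by omega) (by omega) (by omega)
    rw [← hw.per (i - n), ← hw.per (j - n)] at this
    rwa [show i - n + n = i by omega, show j - n + n = j by omega] at this
  · intro h i j hi hij hj
    have := h (i + n) (j + n) (by omega) (by omega) (by omega)
    rwa [hw.per, hw.per] at this

lemma start_shift (hw : CW O n w) (a : ℕ) :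
    (∃ b, Inner G w a b) ↔ ∃ b, Inner G w (a + n) b := by
  constructor
  · rintro ⟨b, h⟩; exact ⟨_, (inner_shift hw a b).1 h⟩
  · rintro ⟨b, h⟩
    have := h.1
    refine ⟨b - n, (inner_shift hw a _).2 ?_⟩
    rwa [show b - n + n = b by omega]

lemma start_shift_mul (hw : CW O n w) (a k : ℕ) :
    (∃ b, Inner G w a b) ↔ ∃ b, Inner G w (a + k * n) b := by
  induction k with
  | zero => simp
  | succ k ih => rw [ih, start_shift hw, Nat.succ_mul, Nat.add_assoc]

open Classical in
/-- Cover of an irreducible closed walk. -/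
lemma cover_irr (hw : CW O n w) (hI : Irr O n w) :
    ∃ 𝒞 : Finset (SignedCircuit G),
      (∀ t, ∃ C ∈ 𝒞, (w t).1 ∈ C.edges) ∧
      ∀ x : E, (𝒞.filter fun C => x ∈ C.edges).card ≤ 2 * mult n w x := by
  have hn := hw.pos
  by_cases hrep : ∃ s t, s < t ∧ t < s + n ∧ hv G (w s) = hv G (w t)
  swap
  · -- a balanced circuit
    push Not at hrep
    have hin : Inner G w 0 (0 + n) :=
      ⟨by omega, by rw [hw.per], fun i j _ hij hj => hrep i j hij (by omega)⟩
    obtain ⟨C, -, eC, bC⟩ := exists_circuit hw hI hin le_rfl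
    have hb : C.Balanced := bC.2 (by rw [hw.per])
    refine ⟨{SignedCircuit.balanced C hb}, ?_, ?_⟩
    · intro t
      refine ⟨_, Finset.mem_singleton_self _, (eC _).2 ⟨t % n, by omega, ?_, ?_⟩⟩
      · have := Nat.mod_lt t hn; omega
      · rw [← per_mul hw.per (t % n) (t / n), Nat.mul_comm, Nat.mod_add_div]
    · intro x
      by_cases hx : x ∈ (SignedCircuit.balanced C hb).edges
      · obtain ⟨t, _, h2, h3⟩ := (eC _).1 hx
        have hpos : 0 < mult n w x :=
          Finset.card_pos.2 ⟨t, by simp only [Finset.mem_filter, Finset.mem_range]; exact ⟨by omega, h3⟩⟩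
        refine (Finset.card_filter_le _ _).trans ?_
        rw [Finset.card_singleton]; omega
      · rw [Finset.filter_singleton, if_neg hx]; simp
  -- every first-return interval is shorter than the period
  have short : ∀ a b, Inner G w a b → b < a + n := by
    intro a b h
    by_contra hc
    obtain ⟨s, t, hst, htn, he⟩ := hrep
    rcases Nat.lt_or_ge (a + n) b with h' | h'
    · exact h.2.2 a (a + n) le_rfl (by omega) h' (by rw [hw.per])
    obtain ⟨s', k, l, p1, p2, p3⟩ := exists_window hw.per hn a s
    obtain ⟨t', k', l', q1, q2, q3⟩ := exists_window hw.per hn a t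
    have es : w s' = w s := by rw [← per_mul hw.per s' k, p3, per_mul hw.per]
    have et : w t' = w t := by rw [← per_mul hw.per t' k', q3, per_mul hw.per]
    have hne : s' ≠ t' := by
      rintro rfl
      have h4 : (s : ℤ) - t = n * ((l' : ℤ) + k - l - k') := by
        have p3' : (s' : ℤ) + k * n = s + l * n := by exact_mod_cast p3
        have q3' : (s' : ℤ) + k' * n = t + l' * n := by exact_mod_cast q3
        linarith
      have h5 : (n : ℤ) ∣ (t : ℤ) - s := by
        rw [← dvd_neg, neg_sub]; exact ⟨_, h4⟩
      have := Int.le_of_dvd (by omega) h5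
      omega
    rcases Nat.lt_or_gt_of_ne hne with h4 | h4
    · exact h.2.2 s' t' p1 h4 (by omega) (by rw [es, et, he])
    · exact h.2.2 t' s' q1 h4 (by omega) (by rw [es, et, he])
  have disj : ∀ a₁ b₁ a₂ b₂, Inner G w a₁ b₁ → Inner G w a₂ b₂ → a₁ < a₂ → b₁ ≤ a₂ := by
    intro a₁ b₁ a₂ b₂ h1 h2 h12
    by_contra hc
    have s1 := short _ _ h1
    have l2 := h2.1
    have hb : b₁ < b₂ := by
      by_contra hb
      rcases Nat.lt_or_ge b₂ b₁ with h | h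
      · exact h1.2.2 a₂ b₂ (by omega) h2.1 h h2.2.1
      · have : b₂ = b₁ := by omega
        subst this
        exact h1.2.2 a₁ a₂ le_rfl h12 (by omega) (h1.2.1.trans h2.2.1.symm)
    rcases Nat.lt_trichotomy b₂ (a₁ + n) with h | h | h
    · exact hI.cross a₁ a₂ b₁ b₂ h12 (by omega) hb h h1.2.1 h2.2.1
    · refine h2.2.2 a₂ b₁ le_rfl (by omega) hb ?_
      rw [h2.2.1, h, hw.per, h1.2.1]
    · refine h2.2.2 b₁ (a₁ + n) (by omega) s1 h ?_
      rw [hw.per, h1.2.1]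
  have main : ∀ a, (∃ b, Inner G w a b) → ∃ (d : ℕ) (S : SignedCircuit G),
      (∀ x, x ∈ S.edges ↔ ∃ t, a ≤ t ∧ t < d ∧ (w t).1 = x) ∧ d ≤ a + n ∧
      (∃ c, a < c ∧ c < d ∧ ∃ b, Inner G w c b) ∧
      (∀ p q, a < p → p < q → (∃ b, Inner G w p b) → (∃ b, Inner G w q b) → d ≤ q) := by
    rintro a ⟨b, hab⟩
    obtain ⟨c, d, hbc, hcd, hdn, hinj⟩ := inner_first hw b
    have sab := short a b hab
    have lab := hab.1
    have hda : d ≤ a + n := by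
      by_contra hc
      exact hinj b (a + n) le_rfl sab (by omega) (by rw [hw.per, hab.2.1])
    obtain ⟨S, hS⟩ := exists_bicircuit hw hI hab hbc hcd hda hinj
    refine ⟨d, S, hS, hda, ⟨c, by omega, hcd.1, d, hcd⟩, ?_⟩
    rintro p q hap hpq ⟨b₂, hp⟩ ⟨b₃, hq⟩
    have h1 := disj _ _ _ _ hab hp hap
    have h2 := disj _ _ _ _ hp hq hpq
    by_contra hc
    exact hinj p b₂ h1 hp.1 (by omega) hp.2.1
  have hne : Nonempty (SignedCircuit G) := by
    obtain ⟨c, d0, _, hcd, _, _⟩ := inner_first hw 0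
    obtain ⟨_, S, _⟩ := main c ⟨d0, hcd⟩
    exact ⟨S⟩
  choose! d S hS hdn hnext hlim using main
  refine ⟨((Finset.range n).filter fun a => ∃ b, Inner G w a b).image S, ?_, ?_⟩
  · intro t
    -- the largest start below `t + n`
    obtain ⟨c, d0, _, hcd, hd0, _⟩ := inner_first hw 0
    have hcl := hcd.1
    let K := (Finset.range (t + n + 1)).filter fun a => ∃ b, Inner G w a b
    have hK : K.Nonempty :=
      ⟨c, by simp only [K, Finset.mem_filter, Finset.mem_range]; exact ⟨by omega, d0, hcd⟩⟩
    have hmem := K.max'_mem hK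
    have hmax : ∀ y ∈ K, y ≤ K.max' hK := fun y hy => K.le_max' y hy
    generalize K.max' hK = a at hmem hmax
    simp only [K, Finset.mem_filter, Finset.mem_range] at hmem hmax
    obtain ⟨hat, hastart⟩ := hmem
    have hdec : a % n + a / n * n = a := by rw [Nat.mul_comm]; exact Nat.mod_add_div a n
    have hst : ∃ b, Inner G w (a % n) b := by
      rw [start_shift_mul hw (a % n) (a / n), hdec]; exact hastart
    refine ⟨S (a % n), Finset.mem_image.2 ⟨a % n, ?_, rfl⟩, ?_⟩
    · rw [Finset.mem_filter, Finset.mem_range]; exact ⟨Nat.mod_lt _ hn, hst⟩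
    · rw [hS _ hst]
      obtain ⟨c', h1, h2, h3⟩ := hnext _ hst
      rw [start_shift_mul hw c' (a / n)] at h3
      have h4 : t + n < c' + a / n * n := by
        by_contra hc
        have := hmax (c' + a / n * n) ⟨by omega, h3⟩
        omega
      refine ⟨t + n - a / n * n, by omega, by omega, ?_⟩
      rw [← per_mul hw.per _ (a / n), show t + n - a / n * n + a / n * n = t + n by omega, hw.per]
  · intro x
    let B : ℕ → Finset ℕ := fun t => (Finset.range (t + 1)).filter fun a =>
      (∃ b, Inner G w a b) ∧ ∀ p q, a < p → p < q → q ≤ t →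
        (∃ b, Inner G w p b) → (∃ b, Inner G w q b) → False
    have hB : ∀ t, (B t).card ≤ 2 := by
      intro t
      by_contra hc
      obtain ⟨x1, x2, x3, m1, m2, m3, n12, n13, n23⟩ := Finset.two_lt_card_iff.1 (not_le.1 hc)
      simp only [B, Finset.mem_filter, Finset.mem_range] at m1 m2 m3
      obtain ⟨r1, k1, l1⟩ := m1
      obtain ⟨r2, k2, l2⟩ := m2
      obtain ⟨r3, k3, l3⟩ := m3
      rcases Nat.lt_or_gt_of_ne n12 with u1 | u1 <;> rcases Nat.lt_or_gt_of_ne n13 with u2 | u2 <;>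
      rcases Nat.lt_or_gt_of_ne n23 with u3 | u3
      · exact l1 x2 x3 u1 u3 (by omega) k2 k3
      · exact l1 x3 x2 u2 u3 (by omega) k3 k2
      · omega
      · exact l3 x1 x2 u2 u1 (by omega) k1 k2
      · exact l2 x1 x3 u1 u2 (by omega) k1 k3
      · omega
      · exact l2 x3 x1 u3 u2 (by omega) k3 k1
      · exact l3 x2 x1 u3 u1 (by omega) k2 k1
    let T := (Finset.Ico n (n + n)).filter fun t => (w t).1 = x
    have hsub : (((Finset.range n).filter fun a => ∃ b, Inner G w a b).image S).filter
        (fun C => x ∈ C.edges) ⊆ T.biUnion fun t => (B t).image fun a => S (a % n) := by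
      intro C hC
      rw [Finset.mem_filter, Finset.mem_image] at hC
      obtain ⟨⟨a, ha, rfl⟩, hx⟩ := hC
      rw [Finset.mem_filter, Finset.mem_range] at ha
      obtain ⟨han, hast⟩ := ha
      obtain ⟨t, h1, h2, h3⟩ := (hS a hast x).1 hx
      have hd := hdn a hast
      have hl := hlim a hast
      rw [Finset.mem_biUnion]
      rcases Nat.lt_or_ge t n with h | h
      · refine ⟨t + n, ?_, Finset.mem_image.2 ⟨a + n, ?_, ?_⟩⟩
        · simp only [T, Finset.mem_filter, Finset.mem_Ico]
          exact ⟨by omega, by rw [hw.per]; exact h3⟩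
        · simp only [B, Finset.mem_filter, Finset.mem_range]
          refine ⟨by omega, (start_shift hw a).1 hast, ?_⟩
          intro p q hap hpq hqt hp hq
          have := hl (p - n) (q - n) (by omega) (by omega)
            ((start_shift hw _).2 (by rwa [show p - n + n = p by omega]))
            ((start_shift hw _).2 (by rwa [show q - n + n = q by omega]))
          omega
        · rw [Nat.add_mod_right, Nat.mod_eq_of_lt han]
      · refine ⟨t, ?_, Finset.mem_image.2 ⟨a, ?_, ?_⟩⟩
        · simp only [T, Finset.mem_filter, Finset.mem_Ico]
          exact ⟨by omega, h3⟩
        · simp only [B, Finset.mem_filter, Finset.mem_range]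
          refine ⟨by omega, hast, ?_⟩
          intro p q hap hpq hqt hp hq
          have := hl p q hap hpq hp hq
          omega
        · rw [Nat.mod_eq_of_lt han]
    calc _ ≤ _ := Finset.card_le_card hsub
      _ ≤ T.card * 2 := Finset.card_biUnion_le_card_mul _ _ _
          (fun t _ => Finset.card_image_le.trans (hB t))
      _ = 2 * mult n w x := by rw [show T.card = _ from window hw.per n x, Nat.mul_comm]

end walk

section flow

variable [Fintype E] [DecidableEq V] {G : SignedGraph V E}

/-- sign of a direction -/
def sg (b : Bool) : ℤ := if b then 1 else -1

/-- signed incidence of a dart at `v` -/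
def bd (O : SOrientation G) (v : V) (p : E × Bool) : ℤ := if hv G p = v then sg (hd O p) else 0

/-- net flow at `v` -/
def net (O : SOrientation G) (f : E → ℤ) (v : V) : ℤ := ∑ x : E, ∑ i : Bool, bd O v (x, i) * f x

lemma bd_step {O : SOrientation G} (v : V) {p q : E × Bool} (h : Step O p q) :
    bd O v (rv p) = - bd O v q := by
  unfold bd
  rw [h.1]
  split_ifs
  · have := h.2
    revert this
    generalize hd O (rv p) = a
    generalize hd O q = b
    revert a b; decide
  · simp

lemma net_mult (O : SOrientation G) (m : ℕ) (u : ℕ → E × Bool) (v : V) :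
    net O (fun x => (mult m u x : ℤ)) v =
      ∑ t ∈ Finset.range m, (bd O v (u t) + bd O v (rv (u t))) := by
  classical
  have h1 : ∀ t, bd O v (u t) + bd O v (rv (u t)) =
      ∑ x : E, if (u t).1 = x then ∑ i : Bool, bd O v (x, i) else 0 := by
    intro t
    rw [Finset.sum_ite_eq]
    simp only [Finset.mem_univ, if_true, Fintype.sum_bool]
    obtain ⟨x, i⟩ := u t
    cases i <;> simp [rv, add_comm]
  simp_rw [h1]
  rw [Finset.sum_comm]
  unfold net
  refine Finset.sum_congr rfl fun x _ => ?_
  rw [← Finset.sum_mul, ← Finset.sum_filter, Finset.sum_const, nsmul_eq_mul, mul_comm]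
  congr 2

lemma net_open (O : SOrientation G) (m : ℕ) (u : ℕ → E × Bool) (v : V)
    (hu : ∀ t < m, Step O (u t) (u (t + 1))) :
    net O (fun x => (mult (m + 1) u x : ℤ)) v = bd O v (u 0) + bd O v (rv (u m)) := by
  rw [net_mult]
  induction m with
  | zero => simp
  | succ m ih =>
    rw [Finset.sum_range_succ, ih (fun t ht => hu t (by omega)), bd_step v (hu m (by omega))]
    ring

lemma net_closed {O : SOrientation G} {n : ℕ} {w : ℕ → E × Bool} (hw : CW O n w) (v : V) :
    net O (fun x => (mult n w x : ℤ)) v = 0 := by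
  have hn := hw.pos
  have h := net_open O (n - 1) w v (fun t _ => hw.step t)
  rw [show n - 1 + 1 = n by omega] at h
  rw [h]
  have := hw.step (n - 1)
  rw [show n - 1 + 1 = 0 + n by omega, hw.per] at this
  rw [bd_step v this]; ring

lemma net_sub (O : SOrientation G) (f g : E → ℤ) (v : V) :
    net O (fun x => f x - g x) v = net O f v - net O g v := by
  unfold net
  rw [← Finset.sum_sub_distrib]
  refine Finset.sum_congr rfl fun x _ => ?_
  rw [← Finset.sum_sub_distrib]
  exact Finset.sum_congr rfl fun i _ => by ring

lemma sum_mult (m : ℕ) (u : ℕ → E × Bool) : ∑ x : E, mult m u x = m := by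
  classical
  have := Finset.card_eq_sum_card_fiberwise (s := Finset.range m) (t := Finset.univ)
    (f := fun t => (u t).1) (fun _ _ => Finset.mem_univ _)
  rw [Finset.card_range] at this
  conv_rhs => rw [this]
  refine Finset.sum_congr rfl fun x _ => ?_
  unfold mult
  congr

lemma mult_succ (m : ℕ) (u : ℕ → E × Bool) (x : E) [Decidable ((u m).1 = x)] :
    mult (m + 1) u x = mult m u x + if (u m).1 = x then 1 else 0 := by
  classical
  unfold mult
  rw [Finset.range_add_one, Finset.filter_insert]
  split_ifs with h
  · rw [Finset.card_insert_of_notMem (by simp)]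
  · rfl

lemma mult_congr (m : ℕ) (u u' : ℕ → E × Bool) (h : ∀ t < m, u t = u' t) (x : E) :
    mult m u x = mult m u' x := by
  classical
  unfold mult
  congr 1
  apply Finset.filter_congr
  intro t ht
  rw [h t (Finset.mem_range.1 ht)]

/-- Existence of a closed walk inside a nonzero flow. -/
lemma exists_closed (O : SOrientation G) (f : E → ℕ) (hf : ∀ v, net O (fun x => (f x : ℤ)) v = 0)
    (hne : ∃ x, f x ≠ 0) : ∃ n w, CW O n w ∧ ∀ x, mult n w x ≤ f x := by
  classical
  let Q : ℕ → Prop := fun m => ∃ u : ℕ → E × Bool,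
    (∀ t < m, Step O (u t) (u (t + 1))) ∧ ∀ x, mult (m + 1) u x ≤ f x
  have hbound : ∀ m, Q m → m ≤ ∑ x, f x := by
    rintro m ⟨u, -, h⟩
    have := Finset.sum_le_sum (fun x (_ : x ∈ Finset.univ) => h x)
    rw [sum_mult] at this
    omega
  have h0 : Q 0 := by
    obtain ⟨x0, hx0⟩ := hne
    refine ⟨fun _ => (x0, true), by omega, fun x => ?_⟩
    rw [mult_succ]
    simp only [mult, Finset.range_zero, Finset.filter_empty, Finset.card_empty]
    split_ifs with h
    · subst h; omega
    · omega
  have hmax := Nat.findGreatest_spec (P := Q) (Nat.zero_le (∑ x, f x)) h0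
  have hgr : ∀ k, Q k → k ≤ Nat.findGreatest Q (∑ x, f x) :=
    fun k hk => Nat.le_findGreatest (hbound k hk) hk
  generalize Nat.findGreatest Q (∑ x, f x) = m at hmax hgr
  obtain ⟨u, hu, hle⟩ := hmax
  have hstuck : ∀ p, Step O (u m) p → f p.1 = mult (m + 1) u p.1 := by
    intro p hp
    by_contra hc
    have hlt : mult (m + 1) u p.1 < f p.1 := lt_of_le_of_ne (hle _) (Ne.symm hc)
    have : Q (m + 1) := by
      refine ⟨fun t => if t ≤ m then u t else p, ?_, ?_⟩
      · intro t ht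
        rcases Nat.lt_or_ge t m with h | h
        · simp only [show t ≤ m by omega, show t + 1 ≤ m by omega, if_true]
          exact hu t h
        · have : t = m := by omega
          subst this
          simpa using hp
      · intro x
        rw [mult_succ, mult_congr (m + 1) _ u]
        · simp only [show ¬ (m + 1 ≤ m) by omega, if_false]
          split_ifs with h
          · subst h; omega
          · exact hle x
        · intro t ht
          simp only [show t ≤ m by omega, if_true]
    have := hgr _ this
    omega
  have hclose : Step O (u m) (u 0) := by
    set v := hv G (rv (u m)) with hvdef
    have h1 := net_open O m u v hu
    have h2 := net_sub O (fun x => (f x : ℤ)) (fun x => (mult (m + 1) u x : ℤ)) v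
    rw [hf, h1] at h2
    have h3 : 0 ≤ sg (hd O (rv (u m))) *
        net O (fun x => (f x : ℤ) - (mult (m + 1) u x : ℤ)) v := by
      unfold net
      rw [Finset.mul_sum]
      refine Finset.sum_nonneg fun x _ => ?_
      rw [Finset.mul_sum]
      refine Finset.sum_nonneg fun i _ => ?_
      by_cases hs : Step O (u m) (x, i)
      · have := hstuck _ hs
        simp only at this ⊢
        rw [this]; simp
      · rw [← mul_assoc]
        refine mul_nonneg ?_ ?_
        · unfold bd
          split_ifs with hh
          · have : hd O (rv (u m)) = hd O (x, i) := by
              by_contra hc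
              exact hs ⟨hh.symm, hc⟩
            rw [this]
            unfold sg; split_ifs <;> norm_num
          · simp
        · have := hle x
          have : (mult (m + 1) u x : ℤ) ≤ f x := by exact_mod_cast this
          linarith
    rw [h2] at h3
    have h4 : bd O v (rv (u m)) = sg (hd O (rv (u m))) := by unfold bd; rw [if_pos hvdef.symm]
    rw [h4] at h3
    unfold bd at h3
    split_ifs at h3 with hh
    · refine ⟨hh.symm, fun hc => ?_⟩
      rw [← hc] at h3
      revert h3
      generalize hd O (rv (u m)) = z
      revert z; decide
    · exfalso
      revert h3
      generalize hd O (rv (u m)) = z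
      revert z; decide
  refine ⟨m + 1, _, mkCW u (by omega) (fun i hi => hu i (by omega)) (by simpa using hclose), ?_⟩
  intro x
  rw [mult_mod]
  exact hle x

open Classical in
lemma cover_flow (O : SOrientation G) (N : ℕ) : ∀ (f : E → ℕ), ∑ x, f x ≤ N →
    (∀ v, net O (fun x => (f x : ℤ)) v = 0) →
    ∃ 𝒞 : Finset (SignedCircuit G),
      (∀ e : E, f e ≠ 0 → ∃ C ∈ 𝒞, e ∈ C.edges) ∧
      ∀ e : E, (𝒞.filter fun C => e ∈ C.edges).card ≤ 2 * f e := by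
  induction N with
  | zero =>
    intro f hN _
    refine ⟨∅, fun e he => ?_, by simp⟩
    have := Finset.single_le_sum (fun x _ => Nat.zero_le (f x)) (Finset.mem_univ e)
    omega
  | succ N ih =>
    intro f hN hf
    by_cases hne : ∃ x, f x ≠ 0
    swap
    · push Not at hne
      exact ⟨∅, fun e he => absurd (hne e) he, by simp⟩
    have hex := exists_closed O f hf hne
    obtain ⟨w, hw, hle⟩ := Nat.find_spec hex
    have hmin := fun m (hm : m < Nat.find hex) => Nat.find_min hex hm
    generalize Nat.find hex = n at hw hle hmin
    have hI : Irr O n w := irr_of_shortest hw fun m hm u hu hc =>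
      hmin m hm ⟨u, hu, fun x => (hc x).trans (hle x)⟩
    obtain ⟨𝒞₁, cov₁, card₁⟩ := cover_irr hw hI
    have hsum : ∑ x, (f x - mult n w x) ≤ N := by
      have h1 : ∑ x, (f x - mult n w x) + ∑ x, mult n w x = ∑ x, f x := by
        rw [← Finset.sum_add_distrib]
        exact Finset.sum_congr rfl fun x _ => Nat.sub_add_cancel (hle x)
      rw [sum_mult] at h1
      have := hw.pos
      omega
    obtain ⟨𝒞₂, cov₂, card₂⟩ := ih (fun x => f x - mult n w x) hsum (by
      intro v
      have : (fun x => ((f x - mult n w x : ℕ) : ℤ)) = fun x => (f x : ℤ) - (mult n w x : ℤ) := by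
        funext x; exact Nat.cast_sub (hle x)
      rw [this, net_sub, hf, net_closed hw]; simp)
    refine ⟨𝒞₁ ∪ 𝒞₂, ?_, ?_⟩
    · intro e he
      by_cases hm : mult n w e = 0
      · obtain ⟨C, hC, h⟩ := cov₂ e (by simpa [hm] using he)
        exact ⟨C, Finset.mem_union_right _ hC, h⟩
      · obtain ⟨t, ht⟩ := Finset.card_pos.1 (Nat.pos_of_ne_zero hm)
        obtain ⟨C, hC, h⟩ := cov₁ t
        rw [(Finset.mem_filter.1 ht).2] at h
        exact ⟨C, Finset.mem_union_left _ hC, h⟩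
    · intro e
      rw [Finset.filter_union]
      refine (Finset.card_union_le _ _).trans ?_
      have h1 := card₁ e
      have h2 := card₂ e
      have h3 := hle e
      omega

lemma net_of_flow (O : SOrientation G) (φ : E → ℤ) (hφ : IsFlow O φ) (v : V) :
    net (O.reorient fun e => decide (φ e < 0)) (fun x => ((φ x).natAbs : ℤ)) v = 0 := by
  have h := sub_eq_zero.2 (hφ v)
  rw [← Finset.sum_sub_distrib] at h
  refine Eq.trans ?_ h
  unfold net
  refine Finset.sum_congr rfl fun x _ => ?_
  rw [← Finset.sum_sub_distrib]
  refine Finset.sum_congr rfl fun i _ => ?_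
  unfold bd hv hd sg SOrientation.reorient
  by_cases hv : G.ends x i = v
  · rcases lt_or_ge (φ x) 0 with hx | hx
    · cases hd : O.dir x i <;> simp [hv, hx, hd, abs_of_neg]
    · cases hd : O.dir x i <;> simp [hv, not_lt.2 hx, hd, abs_of_nonneg hx]
  · simp [hv]

end flow

end CoverAux

open Classical in
/-- If a signed graph `G` admits a nowhere-zero integer flow `φ`, then `G` has
a signed circuit cover in which each edge `e` belongs to at most `2|φ(e)|`
of the signed circuits. -/
theorem cover_with_multiplicity_bound {V E : Type} [Fintype E] [DecidableEq V]
    (G : SignedGraph V E) (O : SOrientation G) (φ : E → ℤ)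
    (hφ : IsFlow O φ) (hnz : ∀ e, φ e ≠ 0) :
    ∃ 𝒞 : Finset (SignedCircuit G),
      (∀ e : E, ∃ C ∈ 𝒞, e ∈ C.edges) ∧
      ∀ e : E, (𝒞.filter fun C => e ∈ C.edges).card ≤ 2 * (φ e).natAbs := by
  obtain ⟨𝒞, h1, h2⟩ := CoverAux.cover_flow (O.reorient fun e => decide (φ e < 0)) _
    (fun x => (φ x).natAbs) le_rfl (CoverAux.net_of_flow O φ hφ)
  exact ⟨𝒞, fun e => h1 e (by simpa using hnz e), h2⟩
end
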